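/- arXiv:2605.18116 — 2 statements merged into one kernel-verified Lean document; each statement's English description precedes it below -/
import Mathlib

section
/- Let K be a field of characteristic zero and let G be a weakly Noetherian Lie algebra over K which is infinite-dimensional and residually semisimple: for every nonzero x ∈ G there is a Lie ideal m of G with x ∉ m such that G/m is a finite-dimensional semisimple Lie algebra. Then G satisfies no nonzero Lie polynomial identity: for every m ≥ 1 and every nonzero element P of the free Lie algebra over K on m generators, there exists a Lie algebra homomorphism f from the free Lie algebra on m generators to G with f(P) ≠ 0. -/
/-- A Lie algebra is weakly Noetherian if `m/[m,m]` is finite dimensional over `K` for every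
Lie subalgebra `m`. -/
def WeaklyNoetherian (K G : Type*) [Field K] [LieRing G] [LieAlgebra K G] : Prop :=
  ∀ m : LieSubalgebra K G,
    FiniteDimensional K (↥m ⧸ LieAlgebra.derivedSeries K ↥m 1)

section FreeLie

attribute [local instance] LieRing.ofAssociativeRing

namespace FreeLieAlgebra

variable {K X : Type*} [Field K]

/-- A Lie subalgebra of a free Lie algebra containing the generators is everything. -/
lemma mem_of_forall_of_mem (S : LieSubalgebra K (FreeLieAlgebra K X))
    (h : ∀ x, of K x ∈ S) (P : FreeLieAlgebra K X) : P ∈ S := by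
  have key : S.incl.comp (lift K fun x ↦ (⟨of K x, h x⟩ : S)) = LieHom.id := by
    ext x
    simp
  have := LieHom.congr_fun key P
  rw [LieHom.id_apply] at this
  rw [← this]
  exact Subtype.property _

/-- Multiplication by a generator on the sum of the free Lie algebra and the scalars. -/
noncomputable def dynkinGen (x : X) : Module.End K (FreeLieAlgebra K X × K) :=
  LinearMap.inl K _ _ ∘ₗ
    ((LieAlgebra.ad K (FreeLieAlgebra K X) (of K x)).coprod
      (LinearMap.toSpanSingleton K _ (of K x)))

/-- The derivation of the free Lie algebra which is the identity on generators. -/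
noncomputable def euler : Module.End K (FreeLieAlgebra K X) :=
  LinearMap.fst K (FreeLieAlgebra K X) K ∘ₗ
    LinearMap.applyₗ ((0 : FreeLieAlgebra K X), (1 : K)) ∘ₗ
      (lift K (dynkinGen (K := K) (X := X)) :
        FreeLieAlgebra K X →ₗ[K] Module.End K (FreeLieAlgebra K X × K))

lemma euler_apply (P : FreeLieAlgebra K X) :
    euler P = (lift K (dynkinGen (K := K) (X := X)) P (0, 1)).1 := rfl

lemma lift_dynkinGen_apply (P : FreeLieAlgebra K X) (v : FreeLieAlgebra K X × K) :
    lift K (dynkinGen (K := K) (X := X)) P v = (⁅P, v.1⁆ + v.2 • euler P, 0) := by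
  let S : LieSubalgebra K (FreeLieAlgebra K X) :=
    { carrier := {P | ∀ v : FreeLieAlgebra K X × K,
        lift K (dynkinGen (K := K) (X := X)) P v = (⁅P, v.1⁆ + v.2 • euler P, 0)}
      add_mem' := by
        intro a b ha hb v
        simp only [map_add, LinearMap.add_apply, ha v, hb v]
        ext <;> simp
        abel
      zero_mem' := by
        intro v
        simp only [map_zero, LinearMap.zero_apply, zero_lie, smul_zero, add_zero]
        rfl
      smul_mem' := by
        intro c a ha v
        simp only [map_smul, LinearMap.smul_apply, ha v]
        ext <;> simp [smul_comm c]
      lie_mem' := by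
        intro a b ha hb v
        have ha (w : FreeLieAlgebra K X × K) :
            lift K (dynkinGen (K := K) (X := X)) a w = (⁅a, w.1⁆ + w.2 • euler a, 0) := ha w
        have hb (w : FreeLieAlgebra K X × K) :
            lift K (dynkinGen (K := K) (X := X)) b w = (⁅b, w.1⁆ + w.2 • euler b, 0) := hb w
        have h (w : FreeLieAlgebra K X × K) :
            lift K (dynkinGen (K := K) (X := X)) ⁅a, b⁆ w =
              (⁅⁅a, b⁆, w.1⁆ + w.2 • (⁅a, euler b⁆ - ⁅b, euler a⁆), 0) := by
          rw [LieHom.map_lie, LieRing.of_associative_ring_bracket]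
          simp only [LinearMap.sub_apply, Module.End.mul_apply, ha, hb]
          ext <;> simp [smul_sub]
          abel
        have h1 : euler ⁅a, b⁆ = ⁅a, euler b⁆ - ⁅b, euler a⁆ := by
          rw [euler_apply, h]; simp
        rw [h, h1] }
  refine mem_of_forall_of_mem S (fun x v ↦ ?_) P v
  have h1 (w : FreeLieAlgebra K X × K) :
      lift K (dynkinGen (K := K) (X := X)) (of K x) w = (⁅of K x, w.1⁆ + w.2 • of K x, 0) := by
    simp [dynkinGen]
  have h2 : euler (of K x) = of K x := by rw [euler_apply, h1]; simp
  rw [h1, h2]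

lemma euler_of (x : X) : euler (of K x) = of K x := by
  rw [euler_apply]; simp [dynkinGen]

lemma euler_lie (a b : FreeLieAlgebra K X) : euler ⁅a, b⁆ = ⁅euler a, b⁆ + ⁅a, euler b⁆ := by
  rw [euler_apply, LieHom.map_lie, LieRing.of_associative_ring_bracket]
  simp only [LinearMap.sub_apply, Module.End.mul_apply, lift_dynkinGen_apply]
  simp
  rw [← lie_skew (euler a) b]
  abel

lemma euler_injective [CharZero K] : Function.Injective (euler (K := K) (X := X)) := by
  let S : LieSubalgebra K (FreeLieAlgebra K X) :=
    { Submodule.span K {v | ∃ n : ℕ, 0 < n ∧ euler v = (n : K) • v} with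
      lie_mem' := by
        intro a b ha hb
        change a ∈ Submodule.span K _ at ha
        change b ∈ Submodule.span K _ at hb
        change _ ∈ Submodule.span K _
        induction ha, hb using Submodule.span_induction₂ with
        | mem_mem x y hx hy =>
          obtain ⟨n, hn, hx⟩ := hx
          obtain ⟨m, hm, hy⟩ := hy
          refine Submodule.subset_span ⟨n + m, by omega, ?_⟩
          rw [euler_lie, hx, hy]
          simp [add_smul]
        | zero_left y hy => simp
        | zero_right x hx => simp
        | add_left x y z hx hy hz h1 h2 => rw [add_lie]; exact add_mem h1 h2
        | add_right x y z hx hy hz h1 h2 => rw [lie_add]; exact add_mem h1 h2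
        | smul_left r x y hx hy h => rw [smul_lie]; exact Submodule.smul_mem _ _ h
        | smul_right r x y hx hy h => rw [lie_smul]; exact Submodule.smul_mem _ _ h }
  have hS (P : FreeLieAlgebra K X) : P ∈ S :=
    mem_of_forall_of_mem S (fun x ↦ Submodule.subset_span ⟨1, one_pos, by simp [euler_of]⟩) P
  have hle : (⊤ : Submodule K (FreeLieAlgebra K X)) ≤
      ⨆ (μ : K) (_ : μ ≠ 0), (euler (K := K) (X := X)).eigenspace μ := by
    intro P _
    have : S.toSubmodule ≤ ⨆ (μ : K) (_ : μ ≠ 0), (euler (K := K) (X := X)).eigenspace μ := by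
      refine Submodule.span_le.mpr ?_
      rintro v ⟨n, hn, hv⟩
      exact Submodule.mem_iSup_of_mem (n : K)
        (Submodule.mem_iSup_of_mem (by exact_mod_cast hn.ne')
          (Module.End.mem_eigenspace_iff.mpr hv))
    exact this (hS P)
  have hdisj := (euler (K := K) (X := X)).eigenspaces_iSupIndep 0
  rw [top_le_iff.mp hle, disjoint_top] at hdisj
  rw [← LinearMap.ker_eq_bot, ← Module.End.eigenspace_zero, hdisj]

/-- Over a field of characteristic zero the free Lie algebra embeds in the free associative
algebra. -/
lemma lift_ι_injective [CharZero K] :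
    Function.Injective (lift K (FreeAlgebra.ι K : X → FreeAlgebra K X)) := by
  rw [← LieHom.coe_toLinearMap, ← LinearMap.ker_eq_bot, LinearMap.ker_eq_bot']
  intro P hP
  apply euler_injective
  have key : (AlgHom.toLieHom (FreeAlgebra.lift K (dynkinGen (K := K) (X := X)))).comp
      (lift K (FreeAlgebra.ι K)) =
      lift K (dynkinGen (K := K) (X := X)) := by
    ext1 x
    simp
  rw [map_zero, euler_apply, ← key]
  rw [LieHom.coe_toLinearMap] at hP
  simp [hP]

end FreeLieAlgebra

end FreeLie

section Polarisation

open Finset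

lemma sum_superset_neg_one_pow_card {ι : Type*} [Fintype ι] [DecidableEq ι] (R : Type*)
    [CommRing R] (T : Finset ι) :
    ∑ S : Finset ι, (if T ⊆ S then (-1 : R) ^ #S else 0) =
      if T = univ then (-1) ^ Fintype.card ι else 0 := by
  have h := Fintype.prod_add (fun _ : ι ↦ (-1 : R)) (fun k ↦ if k ∈ T then 0 else 1)
  have hl : ∏ k : ι, ((-1 : R) + if k ∈ T then 0 else 1) =
      if T = univ then (-1) ^ Fintype.card ι else 0 := by
    split_ifs with hT
    · simp [hT]
    · obtain ⟨k, hk⟩ : ∃ k, k ∉ T := by simpa [eq_univ_iff_forall] using hT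
      exact prod_eq_zero (mem_univ k) (by simp [hk])
  rw [← hl, h]
  refine sum_congr rfl fun S _ ↦ ?_
  rw [prod_const]
  split_ifs with hT
  · rw [prod_eq_one, mul_one]
    intro k hk
    rw [if_neg fun hk' ↦ mem_compl.mp hk (hT hk')]
  · obtain ⟨k, hk, hkS⟩ := not_subset.mp hT
    rw [prod_eq_zero (mem_compl.mpr hkS) (by simp [hk]), mul_zero]

variable {K A X : Type*} [Field K] [Ring A] [Algebra K A]

/-- The signed sum of the values of a monomial on the partial sums indexed by `S`. -/
lemma sum_neg_one_pow_card_smul_prod_ofFn [DecidableEq X] {d e : ℕ} (i : Fin d → X) (u : Fin e → X)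
    (y : Fin d → A) :
    ∑ S : Finset (Fin d), (-1 : K) ^ #S •
        (List.ofFn fun t ↦ ∑ k ∈ S with i k = u t, y k).prod =
      (-1 : K) ^ d • ∑ κ : Fin e → Fin d,
        if Function.Surjective κ ∧ i ∘ κ = u then (List.ofFn (y ∘ κ)).prod else 0 := by
  have h1 (S : Finset (Fin d)) : (List.ofFn fun t ↦ ∑ k ∈ S with i k = u t, y k).prod =
      ∑ κ : Fin e → Fin d, if univ.image κ ⊆ S then
        (if i ∘ κ = u then (List.ofFn (y ∘ κ)).prod else 0) else 0 := by
    rw [← MultilinearMap.mkPiAlgebraFin_apply (R := K), MultilinearMap.map_sum_finset,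
      ← sum_filter, ← sum_filter]
    refine sum_congr ?_ fun κ _ ↦ rfl
    ext κ
    simp [Fintype.mem_piFinset, image_subset_iff, forall_and, funext_iff]
  simp_rw [h1, smul_sum]
  rw [sum_comm]
  refine sum_congr rfl fun κ _ ↦ ?_
  have h2 := sum_superset_neg_one_pow_card K (univ.image κ)
  have h3 : univ.image κ = univ ↔ Function.Surjective κ := by
    simp [eq_univ_iff_forall, Function.Surjective]
  simp_rw [h3, Fintype.card_fin] at h2
  by_cases hu : i ∘ κ = u
  · simp only [hu, if_true, and_true]
    rw [smul_ite, smul_zero, ← ite_zero_smul, ← h2, sum_smul]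
    exact sum_congr rfl fun S _ ↦ by split_ifs <;> simp
  · simp [hu]

lemma sum_neg_one_pow_card_smul_prod_map [DecidableEq X] {d : ℕ} (i : Fin d → X) (w : List X)
    (hw : w.length ≤ d) (y : Fin d → A) :
    ∑ S : Finset (Fin d), (-1 : K) ^ #S • (w.map fun x ↦ ∑ k ∈ S with i k = x, y k).prod =
      (-1 : K) ^ d • ∑ σ : Equiv.Perm (Fin d),
        if List.ofFn (i ∘ σ) = w then (List.ofFn (y ∘ σ)).prod else 0 := by
  obtain ⟨e, u, rfl⟩ : ∃ (e : ℕ) (u : Fin e → X), w = List.ofFn u := ⟨_, _, (List.ofFn_get w).symm⟩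
  simp only [List.length_ofFn] at hw
  have := sum_neg_one_pow_card_smul_prod_ofFn (K := K) i u y
  simp only [List.map_ofFn]
  refine this.trans ?_
  congr 1
  rcases hw.eq_or_lt with rfl | hlt
  · symm
    refine Fintype.sum_of_injective (fun σ : Equiv.Perm (Fin e) ↦ (σ : Fin e → Fin e))
      DFunLike.coe_injective _ _ (fun κ hκ ↦ ?_) fun σ ↦ ?_
    · rw [if_neg]
      rintro ⟨hs, -⟩
      exact hκ ⟨Equiv.ofBijective κ (Finite.surjective_iff_bijective.mp hs), rfl⟩
    · simp [σ.surjective, List.ofFn_inj]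
  · rw [sum_eq_zero, sum_eq_zero]
    · intro σ _
      rw [if_neg]
      intro h
      have := congrArg List.length h
      simp at this
      omega
    · intro κ _
      rw [if_neg]
      rintro ⟨hs, -⟩
      have := Fintype.card_le_of_surjective κ hs
      simp at this
      omega

lemma FreeAlgebra.lift_eq_sum (a : X → A) (q : FreeAlgebra K X) :
    FreeAlgebra.lift K a q = (FreeAlgebra.equivMonoidAlgebraFreeMonoid q).coeff.sum
      fun w c ↦ c • (w.toList.map a).prod := by
  have h : FreeAlgebra.lift K a =
      (MonoidAlgebra.lift K A (FreeMonoid X) (FreeMonoid.lift a)).comp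
        (FreeAlgebra.equivMonoidAlgebraFreeMonoid (R := K) (X := X) : _ →ₐ[K] _) := by
    ext x
    simp [FreeAlgebra.equivMonoidAlgebraFreeMonoid]
  rw [h]
  simp [MonoidAlgebra.lift_apply, FreeMonoid.lift_apply]

/-- Polarisation: an associative polynomial vanishing on a subspace yields a multilinear one. -/
lemma FreeAlgebra.exists_multilinear_of_ne_zero {q : FreeAlgebra K X} (hq : q ≠ 0)
    (V : Submodule K A) (hV : ∀ a : X → A, (∀ x, a x ∈ V) → FreeAlgebra.lift K a q = 0) :
    ∃ (d : ℕ) (α : Equiv.Perm (Fin d) → K), α 1 ≠ 0 ∧ ∀ y : Fin d → A, (∀ k, y k ∈ V) →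
      ∑ σ : Equiv.Perm (Fin d), α σ • (List.ofFn (y ∘ σ)).prod = 0 := by
  classical
  set c := (FreeAlgebra.equivMonoidAlgebraFreeMonoid q).coeff with hc
  have hc0 : c.support.Nonempty := by
    rw [Finsupp.support_nonempty_iff]
    intro h
    apply hq
    apply (FreeAlgebra.equivMonoidAlgebraFreeMonoid (R := K) (X := X)).injective
    rw [map_zero]
    ext w
    simp [← hc, h]
  obtain ⟨w, hw, hmax⟩ := c.support.exists_max_image (fun w ↦ w.toList.length) hc0
  obtain ⟨d, i, hi⟩ : ∃ (d : ℕ) (i : Fin d → X), w.toList = List.ofFn i :=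
    ⟨_, _, (List.ofFn_get _).symm⟩
  refine ⟨d, fun σ ↦ c (FreeMonoid.ofList (List.ofFn (i ∘ σ))), ?_, fun y hy ↦ ?_⟩
  · simpa [← hi] using hw
  have hlen (v) (hv : v ∈ c.support) : v.toList.length ≤ d := by
    simpa [hi] using hmax v hv
  have key : (-1 : K) ^ d • ∑ σ : Equiv.Perm (Fin d),
      c (FreeMonoid.ofList (List.ofFn (i ∘ σ))) • (List.ofFn (y ∘ σ)).prod = 0 := by
    calc _ = ∑ v ∈ c.support, c v • ((-1 : K) ^ d • ∑ σ : Equiv.Perm (Fin d),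
          if List.ofFn (i ∘ σ) = v.toList then (List.ofFn (y ∘ σ)).prod else 0) := by
          simp_rw [smul_comm (c _), ← smul_sum (r := (-1 : K) ^ d), smul_sum (r := c _)]
          rw [sum_comm]
          congr 1
          refine sum_congr rfl fun σ _ ↦ ?_
          simp_rw [smul_ite, smul_zero]
          rw [sum_eq_single (FreeMonoid.ofList (List.ofFn (i ∘ σ)))]
          · simp
          · intro v _ hv
            rw [if_neg]
            intro h
            exact hv (by rw [h]; rfl)
          · intro h
            simp [Finsupp.notMem_support_iff.mp h]
      _ = ∑ S : Finset (Fin d), (-1 : K) ^ #S •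
          FreeAlgebra.lift K (fun x ↦ ∑ k ∈ S with i k = x, y k) q := by
          rw [sum_congr rfl fun v hv ↦ by
            rw [← sum_neg_one_pow_card_smul_prod_map (K := K) i v.toList (hlen v hv) y]]
          simp_rw [FreeAlgebra.lift_eq_sum, ← hc, Finsupp.sum, smul_sum]
          rw [sum_comm]
          exact sum_congr rfl fun S _ ↦ sum_congr rfl fun v _ ↦ smul_comm _ _ _
      _ = 0 := sum_eq_zero fun S _ ↦ by
          rw [hV _ fun x ↦ V.sum_mem fun k _ ↦ hy k, smul_zero]
  exact (smul_eq_zero.mp key).resolve_left (pow_ne_zero _ (neg_ne_zero.mpr one_ne_zero))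

end Polarisation

section LieIdentity

attribute [local instance] LieRing.ofAssociativeRing

/-- A nonzero Lie identity yields a nonzero multilinear associative identity satisfied by the
adjoint representation. -/
lemma FreeLieAlgebra.exists_multilinear_ad_identity {K X G : Type*} [Field K] [CharZero K]
    [LieRing G] [LieAlgebra K G] {P : FreeLieAlgebra K X} (hP : P ≠ 0)
    (h : ∀ f : FreeLieAlgebra K X →ₗ⁅K⁆ G, f P = 0) :
    ∃ (d : ℕ) (α : Equiv.Perm (Fin d) → K), α 1 ≠ 0 ∧ ∀ y : Fin d → G,
      ∑ σ : Equiv.Perm (Fin d), α σ •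
        (List.ofFn fun k ↦ LieAlgebra.ad K G (y (σ k))).prod = 0 := by
  have hq : lift K (FreeAlgebra.ι K : X → FreeAlgebra K X) P ≠ 0 := by
    rwa [Ne, ← map_zero (lift K (FreeAlgebra.ι K : X → FreeAlgebra K X)),
      lift_ι_injective.eq_iff]
  obtain ⟨d, α, hα, H⟩ := FreeAlgebra.exists_multilinear_of_ne_zero hq
    (LinearMap.range (LieAlgebra.ad K G : G →ₗ[K] Module.End K G)) (by
      intro a ha
      choose x hx using ha
      have key : (AlgHom.toLieHom (FreeAlgebra.lift K a)).comp (lift K (FreeAlgebra.ι K)) =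
          (LieAlgebra.ad K G).comp (lift K x) := by
        ext1 t
        simpa using (hx t).symm
      have := LieHom.congr_fun key P
      simpa [h] using this)
  exact ⟨d, α, hα, fun y ↦ H (fun k ↦ LieAlgebra.ad K G (y k)) fun k ↦ ⟨y k, rfl⟩⟩

end LieIdentity

section LieWord

variable {F L : Type*} [Field F] [LieRing L] [LieAlgebra F L]

/-- The iterated bracket `⁅g (m - 1), ⁅…, ⁅g 0, z⁆⁆⁆`. -/
def lieWord (g : ℕ → L) (z : L) : ℕ → L
  | 0 => z
  | m + 1 => ⁅g m, lieWord g z m⁆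

lemma lieWord_succ (g : ℕ → L) (z : L) (m : ℕ) : lieWord g z (m + 1) = ⁅g m, lieWord g z m⁆ := rfl

lemma lieWord_congr {g g' : ℕ → L} (z : L) {m : ℕ} (h : ∀ i < m, g i = g' i) :
    lieWord g z m = lieWord g' z m := by
  induction m with
  | zero => rfl
  | succ m ih => rw [lieWord_succ, lieWord_succ, h m (by omega), ih fun i hi ↦ h i (by omega)]

lemma lieWord_eq_zero {g : ℕ → L} {z : L} {m n : ℕ} (hmn : m ≤ n) (h : lieWord g z m = 0) :
    lieWord g z n = 0 := by
  induction n, hmn using Nat.le_induction with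
  | base => exact h
  | succ n _ ih => rw [lieWord_succ, ih, lie_zero]

variable (F) in
lemma prod_ofFn_ad_apply (d : ℕ) (g : ℕ → L) (z : L) :
    (List.ofFn fun k : Fin d ↦ LieAlgebra.ad F L (g (k.rev : ℕ))).prod z = lieWord g z d := by
  induction d with
  | zero => simp [lieWord]
  | succ d ih =>
    rw [List.ofFn_succ, List.prod_cons, Module.End.mul_apply, lieWord_succ, ← ih,
      LieAlgebra.ad_apply]
    have h1 : ((Fin.rev (0 : Fin (d + 1)) : Fin (d + 1)) : ℕ) = d := by simp
    have h2 (k : Fin d) : ((Fin.rev k.succ : Fin (d + 1)) : ℕ) = k.rev := by simp [Fin.val_rev]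
    simp only [h1, h2]

lemma lie_lieWord_eq_zero {e : ℕ → L} {x : L} {m : ℕ} (h : ∀ i ≤ m, ⁅x, e i⁆ = 0) :
    ⁅x, lieWord (fun k ↦ e (k + 1)) (e 0) m⁆ = 0 := by
  induction m with
  | zero => exact h 0 le_rfl
  | succ m ih =>
    rw [lieWord_succ, leibniz_lie, h (m + 1) le_rfl, ih fun i hi ↦ h i (by omega), zero_lie,
      lie_zero, add_zero]

lemma lie_lieWord_eq_smul {e : ℕ → L} {x : L} {m : ℕ} (h : ∀ i < m, ⁅x, e i⁆ = 0) {c : F}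
    (hc : ⁅x, e m⁆ = c • e m) :
    ⁅x, lieWord (fun k ↦ e (k + 1)) (e 0) m⁆ = c • lieWord (fun k ↦ e (k + 1)) (e 0) m := by
  cases m with
  | zero => exact hc
  | succ m =>
    rw [lieWord_succ, leibniz_lie, hc, lie_lieWord_eq_zero fun i hi ↦ h i (by omega), lie_zero,
      add_zero, smul_lie]

lemma lieWord_ne_zero {e f h : ℕ → L} {c : ℕ → F} {d : ℕ} (he : e 0 ≠ 0)
    (hh0 : ∀ k < d, ∀ i < k, ⁅h (k + 1), e i⁆ = 0)
    (hh1 : ∀ k < d, ⁅h (k + 1), e k⁆ = c k • e k) (hc : ∀ k < d, c k ≠ 0)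
    (hf : ∀ k < d, ∀ i ≤ k, ⁅f (k + 1), e i⁆ = 0)
    (hef : ∀ k < d, ⁅e (k + 1), f (k + 1)⁆ = h (k + 1)) {m : ℕ} (hm : m ≤ d) :
    lieWord (fun k ↦ e (k + 1)) (e 0) m ≠ 0 := by
  induction m with
  | zero => exact he
  | succ m ih =>
    intro h0
    apply ih (by omega)
    have h1 : ⁅f (m + 1), lieWord (fun k ↦ e (k + 1)) (e 0) (m + 1)⁆ = 0 := by rw [h0, lie_zero]
    rw [lieWord_succ, leibniz_lie, lie_lieWord_eq_zero (hf m (by omega)), lie_zero, add_zero,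
      ← lie_skew (f (m + 1)) (e (m + 1)), hef m (by omega), neg_lie, neg_eq_zero,
      lie_lieWord_eq_smul (hh0 m (by omega)) (hh1 m (by omega))] at h1
    exact (smul_eq_zero.mp h1).resolve_left (hc m (by omega))

lemma lieWord_perm_eq_zero {e : ℕ → L} {d : ℕ}
    (hee : ∀ i j, i + 1 < j → j ≤ d → ⁅e j, e i⁆ = 0) {τ : ℕ → ℕ} {m : ℕ} (hm : m < d)
    (hfix : ∀ i < m, τ i = i) (hτm : m < τ m) (hτd : τ m < d) :
    lieWord (fun k ↦ e (τ k + 1)) (e 0) d = 0 := by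
  refine lieWord_eq_zero (m := m + 1) hm ?_
  rw [lieWord_succ, lieWord_congr (g' := fun k ↦ e (k + 1)) _ fun i hi ↦ by rw [hfix i hi]]
  exact lie_lieWord_eq_zero fun i hi ↦ hee _ _ (by omega) (by omega)

/-- A chain of length `d` obstructs multilinear identities of degree `d`. -/
lemma exists_sum_perm_smul_prod_ad_ne_zero {e f h : ℕ → L} {c : ℕ → F} {d : ℕ} (he : e 0 ≠ 0)
    (hh0 : ∀ k < d, ∀ i < k, ⁅h (k + 1), e i⁆ = 0)
    (hh1 : ∀ k < d, ⁅h (k + 1), e k⁆ = c k • e k) (hc : ∀ k < d, c k ≠ 0)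
    (hf : ∀ k < d, ∀ i ≤ k, ⁅f (k + 1), e i⁆ = 0)
    (hef : ∀ k < d, ⁅e (k + 1), f (k + 1)⁆ = h (k + 1))
    (hee : ∀ i j, i + 1 < j → j ≤ d → ⁅e j, e i⁆ = 0)
    (α : Equiv.Perm (Fin d) → F) (hα : α 1 ≠ 0) :
    ∃ y : Fin d → L, ∑ σ : Equiv.Perm (Fin d), α σ •
        (List.ofFn fun k ↦ LieAlgebra.ad F L (y (σ k))).prod ≠ 0 := by
  refine ⟨fun k ↦ e ((k.rev : ℕ) + 1), fun h0 ↦ ?_⟩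
  have h1 := LinearMap.congr_fun h0 (e 0)
  rw [LinearMap.sum_apply, Finset.sum_eq_single 1] at h1
  · have h2 : (List.ofFn fun k : Fin d ↦ LieAlgebra.ad F L
        (e ((((1 : Equiv.Perm (Fin d)) k).rev : ℕ) + 1))).prod (e 0) =
        lieWord (fun k ↦ e (k + 1)) (e 0) d := prod_ofFn_ad_apply F d (fun k ↦ e (k + 1)) (e 0)
    rw [LinearMap.smul_apply, h2, LinearMap.zero_apply] at h1
    exact lieWord_ne_zero he hh0 hh1 hc hf hef le_rfl ((smul_eq_zero.mp h1).resolve_left hα)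
  · intro σ _ hσ
    let τ : ℕ → ℕ := fun m ↦ if hm : m < d then ((σ (Fin.rev ⟨m, hm⟩)).rev : ℕ) else m
    have hτlt (m : ℕ) (hm : m < d) : τ m < d := by simp only [τ, hm, dif_pos]; exact Fin.is_lt _
    have hτ_inj (m m' : ℕ) (hm : m < d) (hm' : m' < d) (hmm : τ m = τ m') : m = m' := by
      simp only [τ, hm, hm', dif_pos] at hmm
      rw [Fin.val_inj, Fin.rev_inj, σ.injective.eq_iff, Fin.rev_inj, Fin.mk.injEq] at hmm
      exact hmm
    have h2 : (List.ofFn fun k : Fin d ↦ LieAlgebra.ad F L (e (((σ k).rev : ℕ) + 1))).prod (e 0) =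
        lieWord (fun k ↦ e (τ k + 1)) (e 0) d := by
      rw [← prod_ofFn_ad_apply F]
      simp only [τ, Fin.is_lt, dif_pos, Fin.eta, Fin.rev_rev]
    have h3 : ∃ m, m < d ∧ τ m ≠ m := by
      by_contra! hcon
      apply hσ
      ext k
      have := hcon k.rev k.rev.is_lt
      simp only [τ, Fin.is_lt, dif_pos, Fin.eta, Fin.rev_rev] at this
      rw [Fin.val_inj, Fin.rev_inj] at this
      simp [this]
    classical
    obtain ⟨hm, hne⟩ := Nat.find_spec h3
    have hmin (i : ℕ) (hi : i < Nat.find h3) : τ i = i := by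
      have := Nat.find_min h3 hi
      by_contra hne
      exact this ⟨by omega, hne⟩
    rw [LinearMap.smul_apply, h2, lieWord_perm_eq_zero hee hm hmin ?_ (hτlt _ hm), smul_zero]
    by_contra! hle
    have h4 : τ (Nat.find h3) < Nat.find h3 := lt_of_le_of_ne hle hne
    exact h4.ne (hτ_inj _ _ (by omega) hm (hmin _ h4))
  · simp

end LieWord

section Chevalley

open LieAlgebra LieAlgebra.IsKilling LieModule

variable {F L : Type*} [Field F] [CharZero F] [LieRing L] [LieAlgebra F L] [FiniteDimensional F L]
  [LieAlgebra.IsKilling F L] {H : LieSubalgebra F L} [H.IsCartanSubalgebra]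
  [LieModule.IsTriangularizable F H L]

lemma LieAlgebra.IsKilling.rootSpace_eq_bot_of_notMem_range_root {χ : Module.Dual F H} (h0 : χ ≠ 0)
    (hχ : χ ∉ Set.range (rootSystem H).root) : rootSpace H (χ : H → F) = ⊥ := by
  by_contra hne
  let w : Weight F H L := ⟨χ, hne⟩
  have hw : w.IsNonZero := by
    intro hz
    apply h0
    ext x
    exact congrFun hz x
  exact hχ ⟨⟨w, by simpa [LieSubalgebra.root] using hw⟩, by ext x; rfl⟩

/-- Chevalley generators attached to a base of the root system. -/
lemma LieAlgebra.IsKilling.exists_chevalley_generators (b : (rootSystem H).Base) :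
    ∃ e f h : b.support → L, (∀ i, e i ≠ 0) ∧ (∀ i, ⁅e i, f i⁆ = h i) ∧
      (∀ i j, ⁅h i, e j⁆ = (rootSystem H).pairing j i • e j) ∧
      (∀ i j, i ≠ j → ⁅f i, e j⁆ = 0) ∧
      (∀ i j, i ≠ j → b.cartanMatrix i j = 0 → ⁅e i, e j⁆ = 0) := by
  choose h e f hsl he hf using fun i : b.support ↦
    exists_isSl2Triple_of_weight_isNonZero (LieSubalgebra.isNonZero_coe_root (i : H.root))
  have hh (i) : h i = coroot ((i : H.root) : Weight F H L) :=
    (hsl i).h_eq_coroot (LieSubalgebra.isNonZero_coe_root _) (he i) (hf i)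
  refine ⟨e, f, h, fun i ↦ (hsl i).e_ne_zero, fun i ↦ (hsl i).lie_e_f, fun i j ↦ ?_,
    fun i j hij ↦ ?_, fun i j hij hA ↦ ?_⟩
  · rw [hh]
    exact lie_eq_smul_of_mem_rootSpace (he j) _
  · have h1 : ⁅f i, e j⁆ ∈ rootSpace H
        (((rootSystem H).root j - (rootSystem H).root i : Module.Dual F H) : H → F) := by
      have := lie_mem_genWeightSpace_of_mem_genWeightSpace (hf i) (he j)
      convert! this using 2
      ext x
      simp [sub_eq_neg_add]
    rw [rootSpace_eq_bot_of_notMem_range_root _ (b.sub_notMem_range_root j.2 i.2)] at h1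
    · simpa using h1
    · rw [Ne, sub_eq_zero, (rootSystem H).root.injective.eq_iff]
      exact fun hc ↦ hij (Subtype.ext hc.symm)
  · have h1 : ⁅e i, e j⁆ ∈ rootSpace H
        (((rootSystem H).root i + (rootSystem H).root j : Module.Dual F H) : H → F) :=
      lie_mem_genWeightSpace_of_mem_genWeightSpace (he i) (he j)
    rw [rootSpace_eq_bot_of_notMem_range_root _
      ((b.cartanMatrix_apply_eq_zero_iff hij).mp hA)] at h1
    · simpa using h1
    · intro h0
      have h2 := b.cartanMatrix_apply_eq_zero_iff_pairing.mp hA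
      rw [add_eq_zero_iff_eq_neg] at h0
      rw [← (rootSystem H).root_coroot_eq_pairing, h0] at h2
      rw [map_neg, LinearMap.neg_apply, RootPairing.root_coroot_eq_pairing,
        RootPairing.pairing_same] at h2
      norm_num at h2

/-- An induced path of length `d` in the Dynkin diagram obstructs multilinear identities of
degree `d`. -/
lemma LieAlgebra.IsKilling.exists_sum_perm_smul_prod_ad_ne_zero (b : (rootSystem H).Base) {d : ℕ}
    (p : ℕ → b.support) (hne : ∀ i j, i < j → j ≤ d → p i ≠ p j)
    (hadj : ∀ i < d, b.cartanMatrix (p i) (p (i + 1)) ≠ 0)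
    (hnadj : ∀ i j, i + 1 < j → j ≤ d → b.cartanMatrix (p i) (p j) = 0)
    (α : Equiv.Perm (Fin d) → F) (hα : α 1 ≠ 0) :
    ∃ y : Fin d → L, ∑ σ : Equiv.Perm (Fin d), α σ •
        (List.ofFn fun k ↦ LieAlgebra.ad F L (y (σ k))).prod ≠ 0 := by
  obtain ⟨e, f, h, he, hef, hhe, hfe, hee⟩ := exists_chevalley_generators b
  refine _root_.exists_sum_perm_smul_prod_ad_ne_zero (e := e ∘ p) (f := f ∘ p) (h := h ∘ p)
    (c := fun k ↦ (rootSystem H).pairing (p k) (p (k + 1))) (he _) (fun k hk i hi ↦ ?_)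
    (fun k hk ↦ hhe _ _) (fun k hk ↦ ?_) (fun k hk i hi ↦ ?_) (fun k hk ↦ hef _)
    (fun i j hij hj ↦ ?_) α hα
  · simp only [Function.comp]
    rw [hhe, b.cartanMatrix_apply_eq_zero_iff_pairing.mp (hnadj i (k + 1) (by omega) (by omega)),
      zero_smul]
  · exact fun h0 ↦ hadj k hk (b.cartanMatrix_apply_eq_zero_iff_pairing.mpr h0)
  · exact hfe _ _ (hne i (k + 1) (by omega) (by omega)).symm
  · exact hee _ _ (hne i j (by omega) hj).symm
      (b.cartanMatrix_apply_eq_zero_iff_symm.mp (hnadj i j hij hj))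

end Chevalley

section Graph

open Finset

/-- In a symmetrisable positive definite generalised Cartan matrix every vertex has at most three
neighbours. -/
lemma Matrix.card_neighbors_le_three {ι : Type*} [Fintype ι] [DecidableEq ι] {A : Matrix ι ι ℤ}
    (hdiag : ∀ i, A i i = 2) (hoff : ∀ i j, i ≠ j → A i j ≤ 0)
    (hsymm : ∀ i j, A i j = 0 → A j i = 0) {d : ι → ℤ} (hd : ∀ i, 0 < d i)
    (hpos : (A * Matrix.diagonal d).PosDef) (i : ι) :
    #{j | j ≠ i ∧ A i j ≠ 0} ≤ 3 := by
  set T : Finset ι := {j | j ≠ i ∧ A i j ≠ 0} with hT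
  have hT' (j) : j ∈ T ↔ j ≠ i ∧ A i j ≠ 0 := by simp [hT]
  have hiT : i ∉ T := by simp [hT']
  set S := A * Matrix.diagonal d with hS
  have hSapp (j k) : S j k = A j k * d k := by simp [hS, Matrix.mul_diagonal]
  have hSsymm (j k) : S j k = S k j := by
    have := hpos.isHermitian.apply k j
    simpa using this
  let x : ι → ℤ := fun j ↦ if j = i then 2 else if j ∈ T then 1 else 0
  have hx : x ≠ 0 := fun h ↦ by simpa [x] using congrFun h i
  have hx0 (j) (hj : j ∉ insert i T) : x j = 0 := by
    rw [mem_insert, not_or] at hj; simp [x, hj.1, hj.2]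
  have hxi : x i = 2 := by simp [x]
  have hxT (j) (hj : j ∈ T) : x j = 1 := by
    simp [x, hj, ((hT' j).mp hj).1]
  have key := hpos.dotProduct_mulVec_pos hx
  have hexp : star x ⬝ᵥ S.mulVec x = ∑ j ∈ insert i T, ∑ k ∈ insert i T, x j * S j k * x k := by
    simp only [dotProduct, Matrix.mulVec, Pi.star_apply, star_trivial, mul_sum, ← mul_assoc]
    rw [← sum_subset (subset_univ (insert i T))]
    · refine sum_congr rfl fun j _ ↦ ?_
      rw [← sum_subset (subset_univ (insert i T))]
      intro k _ hk
      rw [hx0 k hk, mul_zero]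
    · intro j _ hj
      simp [hx0 j hj]
  have h1 (j) (hj : j ∈ T) : ∑ k ∈ insert i T, x j * S j k * x k ≤ 2 * S i j + 2 * d j := by
    rw [sum_insert hiT, hxi, hxT j hj, hSsymm j i]
    have : ∑ k ∈ T, 1 * S j k * x k ≤ S j j := by
      rw [← sum_erase_add _ _ hj, hxT j hj]
      have : ∑ k ∈ T.erase j, 1 * S j k * x k ≤ 0 := by
        refine sum_nonpos fun k hk ↦ ?_
        rw [mem_erase] at hk
        rw [hxT k hk.2, hSapp]
        nlinarith [hoff j k hk.1.symm, hd k]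
      linarith
    rw [hSapp j j, hdiag] at this
    linarith
  have h2 : ∑ k ∈ insert i T, x i * S i k * x k = 8 * d i + ∑ k ∈ T, 2 * S i k := by
    rw [sum_insert hiT, hxi, hSapp i i, hdiag]
    congr 1
    · ring
    · exact sum_congr rfl fun k hk ↦ by rw [hxT k hk, mul_one]
  have h3 (j) (hj : j ∈ T) : S i j ≤ - d j ∧ S i j ≤ - d i := by
    obtain ⟨hji, hA⟩ := (hT' j).mp hj
    have hA1 : A i j ≤ -1 := by have := hoff i j hji.symm; omega
    have hA2 : A j i ≤ -1 := by
      have h1 := hoff j i hji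
      have h2 : A j i ≠ 0 := fun h ↦ hA (hsymm j i h)
      omega
    refine ⟨?_, ?_⟩
    · rw [hSapp]; nlinarith [hd j]
    · rw [hSsymm, hSapp]; nlinarith [hd i]
  rw [hexp, sum_insert hiT, h2] at key
  have h4 : ∑ j ∈ T, ∑ k ∈ insert i T, x j * S j k * x k ≤ ∑ j ∈ T, (2 * S i j + 2 * d j) :=
    sum_le_sum h1
  have h5 : ∑ k ∈ T, 2 * S i k + ∑ j ∈ T, (2 * S i j + 2 * d j) ≤ ∑ _j ∈ T, (-2 * d i) := by
    rw [← sum_add_distrib]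
    refine sum_le_sum fun j hj ↦ ?_
    have := h3 j hj
    linarith
  rw [sum_const, nsmul_eq_mul] at h5
  have h6 : 0 < d i * (4 - #T) := by nlinarith
  have := (pos_iff_pos_of_mul_pos h6).mp (hd i)
  omega

namespace SimpleGraph

variable {V : Type*} {G : SimpleGraph V}

lemma card_dist_le_le [Fintype V] [DecidableEq V] (hG : G.Connected) (r : V) {D : ℕ}
    [DecidableRel G.Adj] (hdeg : ∀ v, #{w | G.Adj v w} ≤ D) (k : ℕ) :
    #{v | G.dist r v ≤ k} ≤ (D + 1) ^ k := by
  induction k with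
  | zero => simp [hG.dist_eq_zero_iff, filter_eq]
  | succ k ih =>
    have hsub : ({v | G.dist r v ≤ k + 1} : Finset V) ⊆
        ({v | G.dist r v ≤ k} : Finset V).biUnion fun u ↦
          insert u ({w | G.Adj u w} : Finset V) := by
      intro v hv
      simp only [mem_filter, mem_univ, true_and] at hv
      simp only [mem_biUnion, mem_filter, mem_univ, true_and, mem_insert]
      rcases hv.eq_or_lt with heq | hlt
      · obtain ⟨w, hw⟩ := hG.exists_walk_length_eq_dist r v
        have hwl : w.length = k + 1 := by omega
        refine ⟨w.getVert k, ?_, Or.inr ?_⟩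
        · refine (dist_le (w.take k)).trans ?_
          rw [Walk.take_length]
          omega
        · have := w.adj_getVert_succ (i := k) (by omega)
          rwa [← hwl, Walk.getVert_length] at this
      · exact ⟨v, by omega, Or.inl rfl⟩
    refine (card_le_card hsub).trans ((card_biUnion_le_card_mul _ _ (D + 1) fun u _ ↦ ?_).trans ?_)
    · exact (card_insert_le _ _).trans (Nat.succ_le_succ (hdeg u))
    · rw [pow_succ]
      exact Nat.mul_le_mul_right _ ih

/-- A large connected graph of bounded degree contains a long geodesic. -/
lemma exists_dist_eq_of_card_lt [Fintype V] [DecidableEq V] (hG : G.Connected) {D d : ℕ}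
    [DecidableRel G.Adj] (hdeg : ∀ v, #{w | G.Adj v w} ≤ D)
    (hcard : (D + 1) ^ d < Fintype.card V) :
    ∃ (r : V) (p : ℕ → V), (∀ k ≤ d, G.dist r (p k) = k) ∧ ∀ k < d, G.Adj (p k) (p (k + 1)) := by
  obtain ⟨r⟩ := hG.nonempty
  obtain ⟨v, hv⟩ : ∃ v, d < G.dist r v := by
    by_contra! h
    have := card_dist_le_le hG r hdeg d
    rw [filter_true_of_mem fun v _ ↦ h v, card_univ] at this
    omega
  obtain ⟨w, hw⟩ := hG.exists_walk_length_eq_dist r v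
  refine ⟨r, w.getVert, fun k hk ↦ ?_, fun k hk ↦ w.adj_getVert_succ (by omega)⟩
  have h1 := dist_le (w.take k)
  have h2 := dist_le (w.drop k)
  have h3 := hG.dist_triangle (u := r) (v := w.getVert k) (w := v)
  rw [Walk.take_length] at h1
  rw [Walk.drop_length] at h2
  omega

end SimpleGraph

end Graph

section DimensionBound

open LieAlgebra LieAlgebra.IsKilling LieModule Module

variable {F L : Type*} [Field F] [CharZero F] [LieRing L] [LieAlgebra F L] [FiniteDimensional F L]

lemma LieAlgebra.IsKilling.finrank_le_finrank_add_card_root [LieAlgebra.IsKilling F L]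
    {H : LieSubalgebra F L} [H.IsCartanSubalgebra] [LieModule.IsTriangularizable F H L] :
    finrank F L ≤ finrank F H + Fintype.card H.root := by
  choose e he using fun α : H.root ↦
    finrank_eq_one_iff'.mp (finrank_rootSpace_eq_one α.1 (LieSubalgebra.isNonZero_coe_root α))
  have htop : H.toSubmodule ⊔ Submodule.span F (Set.range fun α ↦ (e α : L)) = ⊤ := by
    have h1 := LieModule.iSup_genWeightSpace_eq_top' F H L
    rw [← LieSubmodule.toSubmodule_inj, LieSubmodule.iSup_toSubmodule,
      LieSubmodule.top_toSubmodule] at h1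
    rw [eq_top_iff, ← h1]
    refine iSup_le fun χ ↦ ?_
    by_cases hχ : χ.IsZero
    · refine le_trans ?_ le_sup_left
      intro x hx
      rw [hχ] at hx
      replace hx : x ∈ rootSpace H (0 : H → F) := hx
      rwa [rootSpace_zero_eq] at hx
    · refine le_trans ?_ le_sup_right
      intro x hx
      let α : H.root := ⟨χ, by simpa [LieSubalgebra.root] using hχ⟩
      obtain ⟨c, hc⟩ := (he α).2 ⟨x, hx⟩
      have : x = c • (e α : L) := by
        have := congrArg Subtype.val hc
        simpa using this.symm
      rw [this]
      exact Submodule.smul_mem _ _ (Submodule.subset_span ⟨α, rfl⟩)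
  rw [← finrank_top F L, ← htop]
  refine (Submodule.finrank_add_le_finrank_add_finrank _ _).trans ?_
  gcongr
  · exact le_rfl
  · exact finrank_range_le_card _

/-- A finite-dimensional simple Lie algebra over an algebraically closed field whose adjoint
representation satisfies a multilinear identity of degree `d` has dimension bounded in terms of
`d`. -/
lemma LieAlgebra.finrank_le_of_multilinear_ad_identity [IsAlgClosed F] [LieAlgebra.IsSimple F L]
    {d : ℕ} {α : Equiv.Perm (Fin d) → F} (hα : α 1 ≠ 0)
    (h : ∀ y : Fin d → L, ∑ σ : Equiv.Perm (Fin d), α σ •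
        (List.ofFn fun k ↦ LieAlgebra.ad F L (y (σ k))).prod = 0) :
    finrank F L ≤ 4 ^ d + 9 ^ 4 ^ d := by
  classical
  obtain ⟨x, hx⟩ := LieAlgebra.exists_isCartanSubalgebra_engel F L
  set H := LieSubalgebra.engel F x
  have : LieModule.IsTriangularizable F H L := inferInstance
  obtain ⟨b⟩ := (rootSystem H).nonempty_base
  let G : SimpleGraph b.support :=
    { Adj := fun i j ↦ i ≠ j ∧ b.cartanMatrix i j ≠ 0
      symm := ⟨fun i j hij ↦ ⟨hij.1.symm, fun h0 ↦
        hij.2 (b.cartanMatrix_apply_eq_zero_iff_symm.mp h0)⟩⟩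
      loopless := ⟨fun i hi ↦ hi.1 rfl⟩ }
  let _ : DecidableRel G.Adj := Classical.decRel _
  have hne : Nonempty b.support := by
    have := RootPairing.IsIrreducible.nontrivial (P := rootSystem H)
    exact b.toWeightBasis.index_nonempty
  have hconn : G.Connected := by
    rw [SimpleGraph.connected_iff]
    refine ⟨fun i j ↦ ?_, hne⟩
    refine b.induction_on_cartanMatrix (fun j ↦ G.Reachable i j) (SimpleGraph.Reachable.refl i)
      fun k l hk hA ↦ ?_
    by_cases hkl : k = l
    · exact hkl ▸ hk
    · refine hk.trans (SimpleGraph.Adj.reachable ⟨hkl, fun h0 ↦ hA ?_⟩)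
      exact b.cartanMatrix_apply_eq_zero_iff_symm.mp h0
  obtain ⟨D, hD, hpos⟩ := b.exists_cartanMatrix_mul_diagaonal_posDef
  have hdeg (i : b.support) : Finset.card {j | G.Adj i j} ≤ 3 := by
    refine le_trans (le_of_eq ?_) (Matrix.card_neighbors_le_three (A := b.cartanMatrix)
      b.cartanMatrix_apply_same b.cartanMatrix_le_zero_of_ne
      (fun i j ↦ b.cartanMatrix_apply_eq_zero_iff_symm.mp) hD hpos i)
    congr 1
    ext j
    simp [G, ne_comm]
  have hcard : Fintype.card b.support ≤ 4 ^ d := by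
    by_contra! hlt
    obtain ⟨r, p, hp, hadj⟩ := SimpleGraph.exists_dist_eq_of_card_lt (G := G) hconn hdeg hlt
    have hinj (i j : ℕ) (hij : i < j) (hj : j ≤ d) : p i ≠ p j := by
      intro heq
      have h1 := hp i (by omega)
      rw [heq, hp j hj] at h1
      omega
    obtain ⟨y, hy⟩ := LieAlgebra.IsKilling.exists_sum_perm_smul_prod_ad_ne_zero b p
      hinj (fun i hi ↦ (hadj i hi).2) (fun i j hij hj ↦ by
        by_contra h0
        have hadj : G.Adj (p i) (p j) := ⟨hinj i j (by omega) hj, h0⟩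
        have h1 := hconn.dist_triangle (u := r) (v := p i) (w := p j)
        rw [hp i (by omega), hp j hj, SimpleGraph.dist_eq_one_iff_adj.mpr hadj] at h1
        omega) α hα
    exact hy (h y)
  have hH : finrank F H = Fintype.card b.support :=
    finrank_eq_card_basis b.toCoweightBasis
  have hroot : Fintype.card H.root ≤ 9 ^ Fintype.card b.support := by
    have hmem (i j) : (rootSystem H).pairingIn ℤ i j ∈ Finset.Icc (-4 : ℤ) 4 := by
      have := (rootSystem H).pairingIn_pairingIn_mem_set_of_isCrystallographic i j
      simp only [Set.mem_insert_iff, Prod.mk.injEq, Set.mem_singleton_iff] at this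
      rw [Finset.mem_Icc]
      omega
    have := Fintype.card_le_of_injective
      (fun (i : H.root) (k : b.support) ↦
        (⟨(rootSystem H).pairingIn ℤ i k, hmem i k⟩ : Finset.Icc (-4 : ℤ) 4))
      fun i j hij ↦ b.injective_pairingIn (funext fun k ↦ by simpa using congrFun hij k)
    refine this.trans (le_of_eq ?_)
    rw [Fintype.card_fun]
    simp
  refine (LieAlgebra.IsKilling.finrank_le_finrank_add_card_root (H := H)).trans ?_
  rw [hH]
  exact add_le_add hcard (hroot.trans (Nat.pow_le_pow_right (by norm_num) hcard))

end DimensionBound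

section AlternatingTrace

open Function Module

variable {ι F M N : Type*} [Fintype ι] [DecidableEq ι] [Field F] [AddCommGroup M] [Module F M]
  [AddCommGroup N] [Module F N]

/-- The action of an endomorphism on alternating maps by derivations. -/
noncomputable def AlternatingMap.derivative (f : M [⋀^ι]→ₗ[F] N) (T : End F M) :
    M [⋀^ι]→ₗ[F] N where
  __ := ∑ i, f.toMultilinearMap.compLinearMap (update (fun _ ↦ LinearMap.id) i T)
  map_eq_zero_of_eq' := by
    intro v p q hpq hne
    have key (i : ι) : (fun j ↦ (update (fun _ ↦ LinearMap.id) i T : ι → End F M) j (v j)) =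
        update v i (T (v i)) := by
      ext j
      rcases eq_or_ne j i with rfl | hj <;> simp [*]
    simp only [MultilinearMap.toFun_eq_coe, sum_apply,
      MultilinearMap.compLinearMap_apply, key]
    rw [← Finset.sum_subset (Finset.subset_univ {p, q})]
    · rw [Finset.sum_pair hne]
      have hswap : update v p (T (v p)) ∘ Equiv.swap p q = update v q (T (v q)) := by
        ext j
        rcases eq_or_ne j q with rfl | hj
        · simp [hpq]
        rcases eq_or_ne j p with rfl | hj'
        · simp [hj, hne.symm, hpq]
        · simp [Equiv.swap_apply_of_ne_of_ne, hj, hj']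
      have := f.map_add_swap (update v p (T (v p))) hne
      rwa [hswap] at this
    · intro i _ hi
      simp only [Finset.mem_insert, Finset.mem_singleton, not_or] at hi
      exact f.map_eq_zero_of_eq _ (by simp [Ne.symm hi.1, Ne.symm hi.2, hpq]) hne

lemma AlternatingMap.derivative_apply (f : M [⋀^ι]→ₗ[F] N) (T : End F M) (v : ι → M) :
    f.derivative T v = ∑ i, f (update v i (T (v i))) := by
  have key (i : ι) : (fun j ↦ (update (fun _ ↦ LinearMap.id) i T : ι → End F M) j (v j)) =
      update v i (T (v i)) := by
    ext j
    rcases eq_or_ne j i with rfl | hj <;> simp [*]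
  change (∑ i, f.toMultilinearMap.compLinearMap (update (fun _ ↦ LinearMap.id) i T)) v = _
  simp only [sum_apply, MultilinearMap.compLinearMap_apply, key]
  rfl

/-- On an alternating map of top degree, an endomorphism acts by its trace. -/
lemma AlternatingMap.sum_map_update_eq_trace_smul [FiniteDimensional F M]
    (hι : finrank F M = Fintype.card ι)
    (f : M [⋀^ι]→ₗ[F] N) (T : End F M) (v : ι → M) :
    ∑ i, f (update v i (T (v i))) = LinearMap.trace F M T • f v := by
  let b : Basis ι F M := (finBasis F M).reindex ((finCongr hι).trans (Fintype.equivFin ι).symm)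
  suffices f.derivative T = LinearMap.trace F M T • f by
    rw [← derivative_apply, this, smul_apply]
  refine b.ext_alternating fun e he ↦ ?_
  let e' : Equiv.Perm ι := Equiv.ofBijective e (Finite.injective_iff_bijective.mp he)
  rw [derivative_apply, smul_apply, LinearMap.trace_eq_matrix_trace F b, Matrix.trace,
    Finset.sum_smul]
  rw [← Equiv.sum_comp e' fun i ↦ Matrix.diag (LinearMap.toMatrix b b T) i • _]
  refine Finset.sum_congr rfl fun i _ ↦ ?_
  have hT : T (b (e i)) = ∑ k, LinearMap.toMatrix b b T k (e i) • b k := by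
    simp [LinearMap.toMatrix_apply, b.sum_repr]
  rw [hT, map_update_sum, Finset.sum_eq_single (e i)]
  · rw [map_update_smul]
    have : update (fun i ↦ b (e i)) i (b (e i)) = fun i ↦ b (e i) := update_eq_self i _
    rw [this]
    rfl
  · intro k _ hk
    obtain ⟨l, rfl⟩ := e'.surjective k
    rw [map_update_smul, f.map_eq_zero_of_eq _ (i := l) (j := i), smul_zero]
    · have hl : l ≠ i := fun h ↦ hk (by rw [h]; rfl)
      rw [update_of_ne hl, update_self]
      rfl
    · exact fun h ↦ hk (by rw [h]; rfl)
  · simp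

end AlternatingTrace

section Burnside

open Module

variable {F M : Type*} [Field F] [AddCommGroup M] [Module F M]
  [FiniteDimensional F M] [Nontrivial M]

/-- Burnside's theorem: a subalgebra of endomorphisms of a finite-dimensional vector space over
an algebraically closed field without invariant subspaces is everything. -/
lemma Subalgebra.eq_top_of_forall_invariant [IsAlgClosed F] (A : Subalgebra F (End F M))
    (hA : ∀ p : Submodule F M, (∀ a ∈ A, ∀ m ∈ p, a m ∈ p) → p = ⊥ ∨ p = ⊤) : A = ⊤ := by
  have : IsSimpleModule A M := by
    rw [isSimpleModule_iff]
    refine { eq_bot_or_eq_top := fun p ↦ ?_ }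
    rcases hA (p.restrictScalars F) (fun a ha m hm ↦ p.smul_mem ⟨a, ha⟩ hm) with h | h
    · exact Or.inl ((Submodule.restrictScalars_eq_bot_iff _ _ _).mp h)
    · exact Or.inr ((Submodule.restrictScalars_eq_top_iff _ _ _).mp h)
  have hschur := (IsSimpleModule.algebraMap_end_bijective_of_isAlgClosed (A := A) (V := M) F).2
  rw [eq_top_iff]
  intro T _
  let f : End (End A M) M :=
    { toFun := T
      map_add' := T.map_add
      map_smul' := fun g m ↦ by
        obtain ⟨c, rfl⟩ := hschur g
        simp }
  obtain ⟨s, hs⟩ := Module.Finite.fg_top (R := F) (M := M)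
  obtain ⟨r, hr⟩ := jacobson_density (R := A) f s
  have : T = r := by
    refine LinearMap.ext_on_range (v := ((↑) : s → M)) ?_ fun m ↦ hr m m.2
    simpa using hs
  rw [this]
  exact r.2

/-- The two-sided multiplications span all endomorphisms of a matrix algebra. -/
lemma Module.End.span_range_mulLeftRight_eq_top {ι : Type*} (u : ι → End F M)
    (hu : Submodule.span F (Set.range u) = ⊤) :
    Submodule.span F (Set.range fun k : ι × ι ↦
      LinearMap.mulLeft F (u k.1) ∘ₗ LinearMap.mulRight F (u k.2)) = ⊤ := by
  have haz : IsAzumaya F (End F M) := by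
    have : Nonempty (Fin (finrank F M)) := ⟨⟨0, finrank_pos⟩⟩
    have := IsAzumaya.matrix F (Fin (finrank F M))
    exact IsAzumaya.of_AlgEquiv F _ _ (LinearMap.toMatrixAlgEquiv (finBasis F M)).symm
  rw [eq_top_iff]
  intro Z _
  obtain ⟨t, rfl⟩ := haz.bij.2 Z
  induction t with
  | zero => simp
  | add x y hx hy => rw [map_add]; exact add_mem (hx trivial) (hy trivial)
  | tmul a b =>
    have hkey : AlgHom.mulLeftRight F (End F M) (a ⊗ₜ b) =
        LinearMap.mulLeft F a ∘ₗ LinearMap.mulRight F b.unop := by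
      ext x : 1
      simp [mul_assoc]
    rw [hkey]
    let Φ : End F M →ₗ[F] End F M →ₗ[F] End F (End F M) :=
      (LinearMap.llcomp F _ _ _ ∘ₗ LinearMap.mul F (End F M)).compl₂
        (LinearMap.mul F (End F M)).flip
    have hΦ (a b) : Φ a b = LinearMap.mulLeft F a ∘ₗ LinearMap.mulRight F b := rfl
    rw [← hΦ]
    have := Submodule.apply_mem_map₂ Φ (hu.ge (Submodule.mem_top (x := a)))
      (hu.ge (Submodule.mem_top (x := b.unop)))
    rw [Submodule.map₂_span_span] at this
    refine Submodule.span_mono ?_ this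
    rintro _ ⟨_, ⟨i, rfl⟩, _, ⟨j, rfl⟩, rfl⟩
    exact ⟨(i, j), rfl⟩

end Burnside

section AlternatingAd

open Module

variable {F L : Type*} [Field F] [LieRing L] [LieAlgebra F L] {n : ℕ}

/-- The alternating map `x ↦ ∑ σ, sign σ • ∏ k, Z k (ad (x (σ k)))`. -/
noncomputable def LieAlgebra.alternatingAd (Z : Fin n → End F (End F L)) :
    L [⋀^Fin n]→ₗ[F] End F L :=
  ((MultilinearMap.mkPiAlgebraFin F n (End F L)).compLinearMap
    fun k ↦ Z k ∘ₗ (LieAlgebra.ad F L : L →ₗ[F] End F L)).alternatization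

lemma LieAlgebra.alternatingAd_apply (Z : Fin n → End F (End F L)) (x : Fin n → L) :
    alternatingAd Z x = ∑ σ : Equiv.Perm (Fin n),
      Equiv.Perm.sign σ • (List.ofFn fun k ↦ Z k (ad F L (x (σ k)))).prod := by
  simp [alternatingAd, MultilinearMap.alternatization_apply]

lemma LieAlgebra.exists_alternatingAd_ne_zero [FiniteDimensional F L] [Nontrivial L]
    (hinj : Function.Injective (ad F L)) (hn : finrank F L = n)
    {ι γ : Type*} (u : ι → End F L) (hu : Submodule.span F (Set.range u) = ⊤)
    (g : γ → L) (hg : Submodule.span F (Set.range g) = ⊤) :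
    ∃ (i : Fin n → ι × ι) (x : Fin n → γ) (y : γ),
      alternatingAd (fun k ↦ LinearMap.mulLeft F (u (i k).1) ∘ₗ LinearMap.mulRight F (u (i k).2))
        (fun k ↦ g (x k)) (g y) ≠ 0 := by
  by_contra! hcon
  have hcon' (i : Fin n → ι × ι) (x : Fin n → γ) : alternatingAd
      (fun k ↦ LinearMap.mulLeft F (u (i k).1) ∘ₗ LinearMap.mulRight F (u (i k).2))
        (fun k ↦ g (x k)) = 0 := LinearMap.ext_on_range hg fun y ↦ hcon i x y
  have hgen (x : Fin n → γ) (Z : Fin n → End F (End F L)) :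
      alternatingAd Z (fun k ↦ g (x k)) = 0 := by
    let Ψ : MultilinearMap F (fun _ : Fin n ↦ End F (End F L)) (End F L) :=
      ∑ σ : Equiv.Perm (Fin n), Equiv.Perm.sign σ •
        (MultilinearMap.mkPiAlgebraFin F n (End F L)).compLinearMap
          fun k ↦ LinearMap.applyₗ (ad F L (g (x (σ k))))
    have hΨ (Z) : Ψ Z = alternatingAd Z (fun k ↦ g (x k)) := by
      simp [Ψ, alternatingAd_apply, sum_apply]
    have h0 : Ψ = 0 := by
      refine MultilinearMap.ext_of_span_eq_top
        (fun _ ↦ End.span_range_mulLeftRight_eq_top u hu) fun i ↦ ?_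
      rw [hΨ]
      exact hcon' i x
    rw [← hΨ, h0]
    rfl
  have hzero (Z : Fin n → End F (End F L)) : alternatingAd Z = 0 := by
    refine AlternatingMap.coe_multilinearMap_injective ?_
    exact MultilinearMap.ext_of_span_eq_top (fun _ ↦ hg) fun x ↦ hgen x Z
  let e : Module.Basis (Fin n) F L := finBasisOfFinrankEq F L hn
  obtain ⟨r, hr⟩ := LinearMap.exists_leftInverse_of_injective
    (ad F L : L →ₗ[F] End F L) (LinearMap.ker_eq_bot.mpr hinj)
  let Z (k : Fin n) : End F (End F L) := (e.coord k ∘ₗ r).smulRight 1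
  have hr' (x : L) : r (ad F L x) = x := LinearMap.congr_fun hr x
  have h1 := congr($(hzero Z) e)
  rw [alternatingAd_apply, Finset.sum_eq_single 1] at h1
  · have : (List.ofFn fun k ↦ Z k (ad F L (e ((1 : Equiv.Perm (Fin n)) k)))) =
        List.replicate n 1 := by
      rw [← List.ofFn_const]
      congr 1
      ext k : 1
      simp [Z, hr']
    rw [this] at h1
    simp at h1
  · intro σ _ hσ
    have : ∃ k, σ k ≠ k := by
      by_contra! h
      exact hσ (Equiv.ext h)
    obtain ⟨k, hk⟩ := this
    rw [List.prod_eq_zero, smul_zero]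
    rw [List.mem_ofFn]
    refine ⟨k, ?_⟩
    simp [Z, hr', hk]
  · simp

end AlternatingAd

section TraceRing

open Module LieAlgebra

variable {F K J : Type*} [Field F] [Field K] {s : J → Type*} [∀ j, LieRing (s j)]
  [∀ j, LieAlgebra F (s j)] [∀ j, Module K (s j)]

/-- The ring of families of endomorphisms preserving a given subspace of a product. -/
def Submodule.pointwiseEnd (F : Type*) [Field F] [∀ j, LieAlgebra F (s j)]
    (V : Submodule K (∀ j, s j)) : Subring (∀ j, End F (s j)) where
  carrier := {U | ∀ v ∈ V, (fun j ↦ U j (v j)) ∈ V}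
  mul_mem' := fun hU hW v hv ↦ hU _ (hW v hv)
  one_mem' := fun _ hv ↦ hv
  add_mem' := fun hU hW v hv ↦ V.add_mem (hU v hv) (hW v hv)
  zero_mem' := fun _ _ ↦ V.zero_mem
  neg_mem' := fun hU v hv ↦ V.neg_mem (hU v hv)

/-- The algebra of functions generated by the values of the Killing forms on pairs of elements of
a given subspace of a product of Lie algebras. -/
def Submodule.killingAlgebra (F : Type*) [Field F] [Algebra K F] [∀ j, LieAlgebra F (s j)]
    (V : Submodule K (∀ j, s j)) : Subalgebra K (J → F) :=
  Algebra.adjoin K {t | ∃ a ∈ V, ∃ b ∈ V, t = fun j ↦ killingForm F (s j) (a j) (b j)}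

variable {V : Submodule K (∀ j, s j)}

lemma Submodule.ad_mem_pointwiseEnd (hV : ∀ a ∈ V, ∀ b ∈ V, (fun j ↦ ⁅a j, b j⁆) ∈ V)
    {a : ∀ j, s j} (ha : a ∈ V) : (fun j ↦ ad F (s j) (a j)) ∈ V.pointwiseEnd F :=
  fun v hv ↦ hV a ha v hv

lemma Submodule.alternatingAd_mem_pointwiseEnd
    (hV : ∀ a ∈ V, ∀ b ∈ V, (fun j ↦ ⁅a j, b j⁆) ∈ V) {n : ℕ}
    {U W : Fin n → ∀ j, End F (s j)} (hU : ∀ k, U k ∈ V.pointwiseEnd F)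
    (hW : ∀ k, W k ∈ V.pointwiseEnd F) {x : Fin n → ∀ j, s j} (hx : ∀ k, x k ∈ V) :
    (fun j ↦ alternatingAd
      (fun k ↦ LinearMap.mulLeft F (U k j) ∘ₗ LinearMap.mulRight F (W k j))
      (fun k ↦ x k j)) ∈ V.pointwiseEnd F := by
  have key : (fun j ↦ alternatingAd
      (fun k ↦ LinearMap.mulLeft F (U k j) ∘ₗ LinearMap.mulRight F (W k j))
      (fun k ↦ x k j)) = ∑ σ : Equiv.Perm (Fin n), ((Equiv.Perm.sign σ : ℤˣ) : ℤ) •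
        (List.ofFn fun k ↦ U k * ((fun j ↦ ad F (s j) (x (σ k) j)) * W k)).prod := by
    ext j : 1
    rw [alternatingAd_apply, Finset.sum_apply]
    refine Finset.sum_congr rfl fun σ _ ↦ ?_
    rw [Pi.smul_apply, Units.smul_def]
    congr 1
    refine Eq.trans ?_ (map_list_prod (Pi.evalMonoidHom (fun j ↦ End F (s j)) j) _).symm
    rw [List.map_ofFn]
    rfl
  rw [key]
  refine sum_mem fun σ _ ↦ zsmul_mem (list_prod_mem ?_) _
  intro A hA
  rw [List.mem_ofFn] at hA
  obtain ⟨k, rfl⟩ := hA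
  exact mul_mem (hU k) (mul_mem (ad_mem_pointwiseEnd hV (hx _)) (hW k))

lemma Submodule.smul_alternatingAd_mem [Algebra K F] [∀ j, IsScalarTower K F (s j)]
    [∀ j, FiniteDimensional F (s j)]
    (hV : ∀ a ∈ V, ∀ b ∈ V, (fun j ↦ ⁅a j, b j⁆) ∈ V) {n : ℕ}
    (hn : ∀ j, finrank F (s j) = n)
    {U W : Fin n → ∀ j, End F (s j)} (hU : ∀ k, U k ∈ V.pointwiseEnd F)
    (hW : ∀ k, W k ∈ V.pointwiseEnd F) {x : Fin n → ∀ j, s j} (hx : ∀ k, x k ∈ V)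
    {y : ∀ j, s j} (hy : y ∈ V) {r : J → F} (hr : r ∈ V.killingAlgebra F) :
    (fun j ↦ r j • alternatingAd
      (fun k ↦ LinearMap.mulLeft F (U k j) ∘ₗ LinearMap.mulRight F (W k j))
      (fun k ↦ x k j) (y j)) ∈ V := by
  let f (x : Fin n → ∀ j, s j) : ∀ j, s j := fun j ↦ alternatingAd
      (fun k ↦ LinearMap.mulLeft F (U k j) ∘ₗ LinearMap.mulRight F (W k j))
      (fun k ↦ x k j) (y j)
  let S : Submodule K (∀ j, s j) := span K (f '' {x | ∀ k, x k ∈ V})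
  have hS : S ≤ V := by
    refine span_le.mpr ?_
    rintro _ ⟨x, hx, rfl⟩
    exact alternatingAd_mem_pointwiseEnd hV hU hW hx y hy
  suffices H : ∀ v ∈ S, (fun j ↦ r j • v j) ∈ S from
    hS (H _ (subset_span ⟨x, hx, rfl⟩))
  induction hr using Algebra.adjoin_induction with
  | mem r hr =>
    obtain ⟨a, ha, b, hb, rfl⟩ := hr
    intro v hv
    induction hv using span_induction with
    | mem v hv =>
      obtain ⟨x, hx, rfl⟩ := hv
      have : (fun j ↦ killingForm F (s j) (a j) (b j) • f x j) =
          ∑ i, f (Function.update x i fun j ↦ ⁅a j, ⁅b j, x i j⁆⁆) := by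
        ext j
        rw [Finset.sum_apply, LieModule.traceForm_apply_apply]
        have := congr($(AlternatingMap.sum_map_update_eq_trace_smul
          (by rw [hn, Fintype.card_fin])
          (alternatingAd (fun k : Fin n ↦ LinearMap.mulLeft F (U k j) ∘ₗ
            LinearMap.mulRight F (W k j))) (ad F (s j) (a j) ∘ₗ ad F (s j) (b j))
          (fun k ↦ x k j)) (y j))
        rw [LinearMap.smul_apply] at this
        refine this.symm.trans ?_
        rw [LinearMap.sum_apply]
        refine Finset.sum_congr rfl fun i _ ↦ ?_
        simp only [f]
        congr 2
        ext k
        rcases eq_or_ne k i with rfl | hk <;> simp [*]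
      rw [this]
      refine sum_mem fun i _ ↦ subset_span ⟨_, fun k ↦ ?_, rfl⟩
      rcases eq_or_ne k i with rfl | hk
      · simpa using hV a ha _ (hV b hb _ (hx k))
      · simpa [hk] using hx k
    | zero => simp only [Pi.zero_apply, smul_zero]; exact S.zero_mem
    | add v w _ _ hv hw => simpa [smul_add] using! S.add_mem hv hw
    | smul c v _ hv => simpa [smul_comm _ c] using! S.smul_mem c hv
  | algebraMap c =>
    intro v hv
    simpa [Pi.algebraMap_apply, algebraMap_smul] using! S.smul_mem c hv
  | add r t _ _ hr ht =>
    intro v hv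
    simpa [add_smul] using! S.add_mem (hr v hv) (ht v hv)
  | mul r t _ _ hr ht =>
    intro v hv
    simpa [mul_smul] using! hr _ (ht v hv)

end TraceRing

section KillingIdeal

open Module LieAlgebra

attribute [local instance] LieRing.ofAssociativeRing

/-- A subspace of a simple Lie algebra stable under a spanning set is trivial. -/
lemma LieAlgebra.IsSimple.eq_bot_or_eq_top_of_forall_lie_mem {F L : Type*} [Field F] [LieRing L]
    [LieAlgebra F L] [LieAlgebra.IsSimple F L] {S : Set L} (hS : Submodule.span F S = ⊤)
    (p : Submodule F L) (hp : ∀ a ∈ S, ∀ m ∈ p, ⁅a, m⁆ ∈ p) : p = ⊥ ∨ p = ⊤ := by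
  let I : LieIdeal F L :=
    { p with
      lie_mem := by
        intro x m hm
        have hx : x ∈ Submodule.span F S := hS ▸ Submodule.mem_top
        induction hx using Submodule.span_induction with
        | mem a ha => exact hp a ha m hm
        | zero => rw [zero_lie]; exact p.zero_mem
        | add a b _ _ ha hb => rw [add_lie]; exact p.add_mem ha hb
        | smul c a _ ha => rw [smul_lie]; exact p.smul_mem c ha }
  rcases LieAlgebra.IsSimple.eq_bot_or_eq_top (R := F) I with h | h
  · exact Or.inl (by simpa [I] using congr(($h).toSubmodule))
  · exact Or.inr (by simpa [I] using congr(($h).toSubmodule))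

variable {F K J : Type*} [Field F] [Field K] {s : J → Type*} [∀ j, LieRing (s j)]
  [∀ j, LieAlgebra F (s j)] [∀ j, Module K (s j)]
  [∀ j, FiniteDimensional F (s j)] [∀ j, LieAlgebra.IsSimple F (s j)]
  {V : Submodule K (∀ j, s j)}

lemma Submodule.span_pointwiseEnd_eval_eq_top [IsAlgClosed F]
    (hV : ∀ a ∈ V, ∀ b ∈ V, (fun j ↦ ⁅a j, b j⁆) ∈ V) (j : J)
    (hspan : span F (Set.range fun v : V ↦ v.1 j) = ⊤) :
    span F (Set.range fun U : V.pointwiseEnd F ↦ U.1 j) = ⊤ := by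
  have := IsSimple.nontrivial F (s j)
  let M : Submonoid (End F (s j)) :=
    (V.pointwiseEnd F).toSubmonoid.map (Pi.evalMonoidHom (fun j ↦ End F (s j)) j)
  have hM : (Set.range fun U : V.pointwiseEnd F ↦ U.1 j) = M := by
    ext A
    exact ⟨fun ⟨U, hU⟩ ↦ ⟨U.1, U.2, hU⟩, fun ⟨U, hU, h⟩ ↦ ⟨⟨U, hU⟩, h⟩⟩
  have htop : Algebra.adjoin F (M : Set (End F (s j))) = ⊤ := by
    refine Subalgebra.eq_top_of_forall_invariant _ fun p hp ↦ ?_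
    refine IsSimple.eq_bot_or_eq_top_of_forall_lie_mem hspan p ?_
    rintro _ ⟨a, rfl⟩ m hm
    exact hp (ad F (s j) (a.1 j)) (Algebra.subset_adjoin
      ⟨_, ad_mem_pointwiseEnd hV a.2, rfl⟩) m hm
  have := Algebra.adjoin_eq_span F (M : Set (End F (s j)))
  rw [htop, Algebra.top_toSubmodule, Submonoid.closure_eq] at this
  rw [hM, this]

/-- The largest subspace of `V` stable under the algebra generated by the values of the Killing
forms has nonzero image in every factor. -/
lemma Submodule.exists_forall_killingAlgebra_smul_mem [IsAlgClosed F] [CharZero F]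
    [Algebra K F] [∀ j, IsScalarTower K F (s j)]
    (hV : ∀ a ∈ V, ∀ b ∈ V, (fun j ↦ ⁅a j, b j⁆) ∈ V) {n : ℕ}
    (hn : ∀ j, finrank F (s j) = n) (j : J)
    (hspan : span F (Set.range fun v : V ↦ v.1 j) = ⊤) :
    ∃ v : ∀ j, s j, v j ≠ 0 ∧ ∀ r ∈ V.killingAlgebra F, (fun j ↦ r j • v j) ∈ V := by
  have := IsSimple.nontrivial F (s j)
  obtain ⟨i, x, y, h⟩ := exists_alternatingAd_ne_zero (F := F) (L := s j)
    ((LieHom.ker_eq_bot _).mp (ad_ker_eq_bot_of_hasTrivialRadical F (s j))) (hn j)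
    _ (span_pointwiseEnd_eval_eq_top hV j hspan) _ hspan
  exact ⟨_, h, fun r hr ↦ smul_alternatingAd_mem hV hn (fun k ↦ (i k).1.2)
    (fun k ↦ (i k).2.2) (fun k ↦ (x k).2) y.2 hr⟩

end KillingIdeal

section KillingCharacters

open Module LieAlgebra

/-- A family of multiplicative maps that factor through a finite-dimensional space is finite. -/
lemma MonoidHom.finite_of_factor_finiteDimensional {K F R A : Type*} [Field K] [Field F]
    [Algebra K F] [Monoid R] [AddCommGroup A] [Module K A] [FiniteDimensional K A] (θ : R → A)
    (X : Set (R →* F)) (hX : ∀ χ ∈ X, ∃ ψ : A →ₗ[K] F, ∀ r, χ r = ψ (θ r)) : X.Finite := by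
  let T : (A →ₗ[K] F) →ₗ[F] (R → F) :=
    { toFun := fun ψ r ↦ ψ (θ r)
      map_add' := fun _ _ ↦ rfl
      map_smul' := fun _ _ ↦ rfl }
  have hmem (χ : X) : (χ.1 : R → F) ∈ LinearMap.range T := by
    obtain ⟨ψ, hψ⟩ := hX χ χ.2
    exact ⟨ψ, funext fun r ↦ (hψ r).symm⟩
  have hli : LinearIndependent F (fun χ : X ↦ (⟨χ.1, hmem χ⟩ : LinearMap.range T)) := by
    refine LinearIndependent.of_comp (LinearMap.range T).subtype ?_
    exact (linearIndependent_monoidHom R F).comp ((↑) : X → (R →* F)) Subtype.val_injective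
  exact hli.finite

variable {F K J : Type*} [Field F] [Field K] [CharZero F] {s : J → Type*}
  [∀ j, LieRing (s j)] [∀ j, LieAlgebra F (s j)] [∀ j, Module K (s j)]
  [∀ j, FiniteDimensional F (s j)] [∀ j, LieAlgebra.IsSimple F (s j)]
  {V : Submodule K (∀ j, s j)}

lemma Submodule.eval_eq_zero_iff_killingForm {j : J}
    (hspan : span F (Set.range fun v : V ↦ v.1 j) = ⊤) (x : s j) :
    x = 0 ↔ ∀ b ∈ V, killingForm F (s j) x (b j) = 0 := by
  refine ⟨by rintro rfl; simp, fun h ↦ ?_⟩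
  refine (IsKilling.killingForm_nondegenerate F (s j)).1 x fun y ↦ ?_
  have : killingForm F (s j) x = 0 := LinearMap.ext_on_range hspan fun b ↦ h b b.2
  rw [this, LinearMap.zero_apply]

lemma Submodule.finite_image_inf_ker_proj [Algebra K F] [∀ j, IsScalarTower K F (s j)]
    (hspan : ∀ j, span F (Set.range fun v : V ↦ v.1 j) = ⊤)
    (hab : ∀ A ≤ V, (∀ a ∈ A, ∀ b ∈ A, ∀ j, ⁅a j, b j⁆ = 0) → FiniteDimensional K A)
    {v : ∀ j, s j} (hv : ∀ r ∈ V.killingAlgebra F, (fun j ↦ r j • v j) ∈ V) :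
    ((fun j ↦ V ⊓ LinearMap.ker (LinearMap.proj j : (∀ j, s j) →ₗ[K] s j)) ''
      {j | v j ≠ 0}).Finite := by
  let θ : V.killingAlgebra F →ₗ[K] ∀ j, s j :=
    { toFun := fun r j ↦ r.1 j • v j
      map_add' := fun r t ↦ funext fun j ↦ add_smul _ _ _
      map_smul' := fun c r ↦ funext fun j ↦ smul_assoc _ _ _ }
  have hfin : FiniteDimensional K (LinearMap.range θ) := by
    refine hab _ ?_ ?_
    · rintro _ ⟨r, rfl⟩
      exact hv r r.2
    · rintro _ ⟨r, rfl⟩ _ ⟨t, rfl⟩ j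
      simp [θ]
  let χ (j : J) : V.killingAlgebra F →* F :=
    ((Pi.evalMonoidHom (fun _ : J ↦ F) j).comp
      ((V.killingAlgebra F).val : V.killingAlgebra F →* (J → F)))
  have hχ : (χ '' {j | v j ≠ 0}).Finite := by
    refine MonoidHom.finite_of_factor_finiteDimensional (K := K) θ.rangeRestrict _ ?_
    rintro _ ⟨j, hj, rfl⟩
    obtain ⟨l, hl⟩ := Projective.exists_dual_eq_one F hj
    refine ⟨l.restrictScalars K ∘ₗ LinearMap.proj j ∘ₗ (LinearMap.range θ).subtype, fun r ↦ ?_⟩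
    simp [θ, χ, hl]
  have hker (j k : J) (h : χ j = χ k) :
      V ⊓ LinearMap.ker (LinearMap.proj j : (∀ j, s j) →ₗ[K] s j) =
        V ⊓ LinearMap.ker (LinearMap.proj k : (∀ j, s j) →ₗ[K] s k) := by
    ext g
    simp only [mem_inf, LinearMap.mem_ker, LinearMap.proj_apply, and_congr_right_iff]
    intro hg
    rw [eval_eq_zero_iff_killingForm (hspan j), eval_eq_zero_iff_killingForm (hspan k)]
    refine forall₂_congr fun b hb ↦ ?_
    have := DFunLike.congr_fun h ⟨_, Algebra.subset_adjoin ⟨g, hg, b, hb, rfl⟩⟩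
    exact Eq.congr this rfl
  obtain ⟨S, -, hS⟩ := Set.exists_subset_bijOn {j | v j ≠ 0} χ
  refine ((hS.finite_iff_finite.mpr hχ).image fun j ↦
    V ⊓ LinearMap.ker (LinearMap.proj j : (∀ j, s j) →ₗ[K] s j)).subset ?_
  rintro _ ⟨j, hj, rfl⟩
  obtain ⟨k, hk, hkj⟩ := hS.surjOn ⟨j, hj, rfl⟩
  exact ⟨k, hk, hker k j hkj⟩

end KillingCharacters

section ProductFiniteDimensional

open Module LieAlgebra

variable {F K J : Type*} [Field F] [IsAlgClosed F] [Field K] [Algebra K F]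
  {s : J → Type*} [∀ j, LieRing (s j)] [∀ j, LieAlgebra F (s j)] [∀ j, Module K (s j)]
  [∀ j, FiniteDimensional F (s j)] [∀ j, LieAlgebra.IsSimple F (s j)]
  {V : Submodule K (∀ j, s j)}

lemma Submodule.exists_killingAlgebra_smul_mem_of_mem
    (hV : ∀ a ∈ V, ∀ b ∈ V, (fun j ↦ ⁅a j, b j⁆) ∈ V) {j : J}
    (hspan : span F (Set.range fun v : V ↦ v.1 j) = ⊤)
    {a w : ∀ j, s j} (ha : a ∈ V) (haj : a j ≠ 0) (hwj : w j ≠ 0)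
    (hw : ∀ r ∈ V.killingAlgebra F, (fun j ↦ r j • w j) ∈ V) :
    ∃ w' : ∀ j, s j, w' j ≠ 0 ∧ (∀ r ∈ V.killingAlgebra F, (fun j ↦ r j • w' j) ∈ V) ∧
      (∀ i, w i = 0 → w' i = 0) ∧ ∀ i, a i = 0 → w' i = 0 := by
  obtain ⟨U, hU⟩ : ∃ U : V.pointwiseEnd F, ⁅a j, U.1 j (w j)⁆ ≠ 0 := by
    by_contra! h
    have hzero : (ad F (s j) (a j) : End F (s j)) ∘ₗ LinearMap.applyₗ (w j) = 0 :=
      LinearMap.ext_on_range (span_pointwiseEnd_eval_eq_top hV j hspan) fun U ↦ h U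
    obtain ⟨l, hl⟩ := Projective.exists_dual_eq_one F hwj
    have hcenter : a j ∈ LieAlgebra.center F (s j) := by
      rw [LieModule.mem_maxTrivSubmodule]
      intro x
      have := LinearMap.congr_fun hzero (l.smulRight x)
      rw [← lie_skew, neg_eq_zero]
      simpa [hl] using this
    rw [LieAlgebra.center_eq_bot] at hcenter
    exact haj hcenter
  refine ⟨fun i ↦ ⁅a i, U.1 i (w i)⁆, hU, fun r hr ↦ ?_, fun i hi ↦ ?_, fun i hi ↦ ?_⟩
  · have := hV a ha _ (U.2 _ (hw r hr))
    simpa using this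
  · simp [hi]
  · simp [hi]

variable [CharZero F] [∀ j, IsScalarTower K F (s j)]

lemma Submodule.exists_mem_finset_killingAlgebra_smul_mem
    (hV : ∀ a ∈ V, ∀ b ∈ V, (fun j ↦ ⁅a j, b j⁆) ∈ V) {n : ℕ}
    (hn : ∀ j, finrank F (s j) = n) {j : J}
    (hspan : span F (Set.range fun v : V ↦ v.1 j) = ⊤)
    (T : Finset (Submodule K (∀ j, s j)))
    (hT : ∀ p ∈ T, p ≤ V ∧ ¬ p ≤ LinearMap.ker (LinearMap.proj j : (∀ j, s j) →ₗ[K] s j)) :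
    ∃ w : ∀ j, s j, w j ≠ 0 ∧ (∀ r ∈ V.killingAlgebra F, (fun j ↦ r j • w j) ∈ V) ∧
      ∀ p ∈ T, ∀ i, (∀ a ∈ p, a i = 0) → w i = 0 := by
  classical
  induction T using Finset.induction_on with
  | empty =>
    obtain ⟨w, hw, hr⟩ := exists_forall_killingAlgebra_smul_mem hV hn j hspan
    exact ⟨w, hw, hr, by simp⟩
  | insert p T _ ih =>
    obtain ⟨w, hw, hr, hwT⟩ := ih fun q hq ↦ hT q (Finset.mem_insert_of_mem hq)
    obtain ⟨hpV, hp⟩ := hT p (Finset.mem_insert_self p T)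
    obtain ⟨a, hap, haj⟩ := SetLike.not_le_iff_exists.mp hp
    obtain ⟨w', h1, h2, h3, h4⟩ :=
      exists_killingAlgebra_smul_mem_of_mem hV hspan (hpV hap) haj hw hr
    refine ⟨w', h1, h2, fun q hq i hi ↦ ?_⟩
    rcases Finset.mem_insert.mp hq with rfl | hq
    · exact h4 i (hi a hap)
    · exact h3 i (hwT q hq i hi)

/-- A sequence of nonzero elements of a product with disjoint supports is linearly independent. -/
lemma Pi.linearIndependent_of_disjoint_support {K J ι : Type*} [Field K] {s : J → Type*}
    [∀ j, AddCommGroup (s j)] [∀ j, Module K (s j)] {u : ι → ∀ j, s j} (hu : ∀ i, u i ≠ 0)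
    (hdisj : ∀ i k, i ≠ k → ∀ j, u i j = 0 ∨ u k j = 0) : LinearIndependent K u := by
  rw [linearIndependent_iff']
  intro S c hc i hi
  obtain ⟨j, hj⟩ := Function.ne_iff.mp (hu i)
  have := congrFun hc j
  rw [Finset.sum_apply, Finset.sum_eq_single i] at this
  · simpa [show u i j ≠ 0 from hj] using this
  · intro k _ hk
    simp [(hdisj i k hk.symm j).resolve_left hj]
  · exact fun h ↦ absurd hi h

/-- A Lie subring of a product of simple Lie algebras of the same dimension over an algebraically
closed field, whose images are finite dimensional and spanning with incomparable kernels and whose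
abelian subspaces are finite dimensional, is finite dimensional. -/
theorem Submodule.finiteDimensional_of_abelian_finiteDimensional
    (hV : ∀ a ∈ V, ∀ b ∈ V, (fun j ↦ ⁅a j, b j⁆) ∈ V) {n : ℕ}
    (hn : ∀ j, finrank F (s j) = n)
    (hspan : ∀ j, span F (Set.range fun v : V ↦ v.1 j) = ⊤)
    (hfin : ∀ j, FiniteDimensional K (V.map (LinearMap.proj j : (∀ j, s j) →ₗ[K] s j)))
    (hmax : ∀ j k, (∀ v ∈ V, v j = 0 → v k = 0) → ∀ v ∈ V, v k = 0 → v j = 0)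
    (hab : ∀ A ≤ V, (∀ a ∈ A, ∀ b ∈ A, ∀ j, ⁅a j, b j⁆ = 0) → FiniteDimensional K A) :
    FiniteDimensional K V := by
  let κ (j : J) : Submodule K (∀ j, s j) :=
    V ⊓ LinearMap.ker (LinearMap.proj j : (∀ j, s j) →ₗ[K] s j)
  by_cases hκ : (Set.range κ).Finite
  · obtain ⟨S, -, hS⟩ := Set.exists_subset_bijOn Set.univ κ
    rw [Set.image_univ] at hS
    have : Finite S := hS.finite_iff_finite.mpr hκ
    let Ψ : V →ₗ[K] ∀ j : S, V.map (LinearMap.proj j.1 : (∀ j, s j) →ₗ[K] s j.1) :=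
      LinearMap.pi fun j ↦ (LinearMap.proj j.1).submoduleMap V
    refine FiniteDimensional.of_injective Ψ ?_
    rw [injective_iff_map_eq_zero]
    intro v hv
    ext k
    obtain ⟨j, hj, hjk⟩ := hS.surjOn ⟨k, rfl⟩
    have hvj : v.1 ∈ κ j := ⟨v.2, congr(($hv ⟨j, hj⟩).1)⟩
    rw [hjk] at hvj
    exact hvj.2
  · exfalso
    obtain ⟨u, hu, hdisj⟩ := exists_seq_of_forall_finset_exists
      (fun u : ∀ j, s j ↦ u ∈ V ∧ u ≠ 0 ∧ (κ '' {j | u j ≠ 0}).Finite)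
      (fun u v ↦ ∀ j, u j = 0 ∨ v j = 0) (by
        intro S hS
        have hfinT : (⋃ u ∈ S, κ '' {j | u j ≠ 0}).Finite :=
          S.finite_toSet.biUnion fun u hu ↦ (hS u hu).2.2
        obtain ⟨p, ⟨j, rfl⟩, hj⟩ := Set.Infinite.exists_notMem_finite hκ hfinT
        obtain ⟨w, hw, hr, hwT⟩ := exists_mem_finset_killingAlgebra_smul_mem hV hn (hspan j)
          hfinT.toFinset (by
            intro p hp
            rw [Set.Finite.mem_toFinset] at hp
            have hpj : p ≠ κ j := fun h ↦ hj (h ▸ hp)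
            simp only [Set.mem_iUnion] at hp
            obtain ⟨u, hu, k, hk, rfl⟩ := hp
            refine ⟨inf_le_left, fun hle ↦ hpj ?_⟩
            have hkj : ∀ v ∈ V, v k = 0 → v j = 0 := fun v hv h0 ↦ hle ⟨hv, h0⟩
            refine le_antisymm (fun v hv ↦ ⟨hv.1, hkj v hv.1 hv.2⟩) fun v hv ↦
              ⟨hv.1, hmax k j hkj v hv.1 hv.2⟩)
        refine ⟨w, ⟨by simpa using hr 1 (one_mem _), fun h ↦ hw (by rw [h]; rfl),
          finite_image_inf_ker_proj hspan hab hr⟩, fun u hu k ↦ ?_⟩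
        by_cases hk : u k = 0
        · exact Or.inl hk
        · refine Or.inr (hwT (κ k) ?_ k fun a ha ↦ ha.2)
          rw [Set.Finite.mem_toFinset]
          exact Set.mem_biUnion hu ⟨k, hk, rfl⟩)
    have hdisj' (i k : ℕ) (hik : i ≠ k) (j : J) : u i j = 0 ∨ u k j = 0 := by
      rcases hik.lt_or_gt with h | h
      · exact hdisj i k h j
      · exact (hdisj k i h j).symm
    have hli := Pi.linearIndependent_of_disjoint_support (K := K) (fun i ↦ (hu i).2.1) hdisj'
    have := hab (span K (Set.range u))
      (span_le.mpr (by rintro _ ⟨i, rfl⟩; exact (hu i).1)) (by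
        intro a ha b hb j
        induction ha, hb using span_induction₂ with
        | mem_mem a b ha hb =>
          obtain ⟨i, rfl⟩ := ha
          obtain ⟨k, rfl⟩ := hb
          rcases eq_or_ne i k with rfl | hik
          · exact lie_self _
          · rcases hdisj' i k hik j with h | h <;> simp [h]
        | zero_left => simp
        | zero_right => simp
        | add_left _ _ _ _ _ _ h1 h2 => simp [h1, h2]
        | add_right _ _ _ _ _ _ h1 h2 => simp [h1, h2]
        | smul_left c a b _ _ h =>
          rw [Pi.smul_apply, ← algebraMap_smul F c, smul_lie, h, smul_zero]
        | smul_right c a b _ _ h =>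
          rw [Pi.smul_apply, ← algebraMap_smul F c, lie_smul, h, smul_zero])
    have hli' := linearIndependent_span hli
    exact not_finite_iff_infinite.mpr inferInstance hli'.finite

end ProductFiniteDimensional

section SimpleQuotient

open Module LieAlgebra
open scoped TensorProduct

/-- The quotient of a Lie algebra by a maximal ideal not containing the derived ideal is simple. -/
lemma LieIdeal.isSimple_quotient {K L : Type*} [Field K] [LieRing L] [LieAlgebra K L]
    {c : LieIdeal K L} (hc : IsCoatom c) (hnon : ∃ x y : L, ⁅x, y⁆ ∉ c) :
    LieAlgebra.IsSimple K (L ⧸ c) where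
  eq_bot_or_eq_top I := by
    let p : L →ₗ[K] L ⧸ c := (LieSubmodule.Quotient.mk' c : L →ₗ[K] L ⧸ c)
    have hp : Function.Surjective p := LieSubmodule.Quotient.surjective_mk' c
    let N : LieIdeal K L :=
      { I.toSubmodule.comap p with
        lie_mem := fun {x m} hm ↦ by
          change p ⁅x, m⁆ ∈ I
          exact lie_mem_right K (L ⧸ c) I (p x) (p m) hm }
    have hN (x : L) : x ∈ N ↔ p x ∈ I := Iff.rfl
    have hle : c ≤ N := fun x hx ↦ by
      rw [hN, show p x = 0 from LieSubmodule.Quotient.mk_eq_zero'.mpr hx]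
      exact I.zero_mem
    rcases hc.le_iff.mp hle with h | h
    · refine Or.inr (eq_top_iff.mpr fun y _ ↦ ?_)
      obtain ⟨x, rfl⟩ := hp y
      rw [← hN, h]
      trivial
    · refine Or.inl (eq_bot_iff.mpr fun y hy ↦ ?_)
      obtain ⟨x, rfl⟩ := hp y
      rw [← hN, h] at hy
      exact LieSubmodule.Quotient.mk_eq_zero'.mpr hy
  non_abelian h := by
    obtain ⟨x, y, hxy⟩ := hnon
    refine hxy (LieSubmodule.Quotient.mk_eq_zero'.mp ?_)
    rw [LieSubmodule.Quotient.mk_bracket]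
    exact h.trivial _ _

/-- A nonzero element of a semisimple Lie algebra survives in a simple quotient. -/
lemma LieAlgebra.IsSemisimple.exists_isCoatom_notMem {K L : Type*} [Field K] [LieRing L]
    [LieAlgebra K L] [FiniteDimensional K L] [LieAlgebra.IsSemisimple K L] {x : L} (hx : x ≠ 0) :
    ∃ c : LieIdeal K L, IsCoatom c ∧ x ∉ c ∧ ∃ y z : L, ⁅y, z⁆ ∉ c := by
  have hspan : LieSubmodule.lieSpan K L {x} ≠ ⊥ := by
    rw [Ne, LieSubmodule.lieSpan_eq_bot_iff]
    simpa using hx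
  obtain ⟨a, ha, hax⟩ := (IsAtomic.eq_bot_or_exists_atom_le
    (LieSubmodule.lieSpan K L {x} : LieIdeal K L)).resolve_left hspan
  obtain ⟨c, hac⟩ := exists_isCompl a
  refine ⟨c, hac.isAtom_iff_isCoatom.mp ha, fun hxc ↦ ?_, ?_⟩
  · have : a ≤ c := hax.trans (LieSubmodule.lieSpan_le.mpr (by simpa using hxc))
    exact ha.1 (le_bot_iff.mp (hac.disjoint le_rfl this))
  · by_contra! h
    refine LieAlgebra.IsSemisimple.non_abelian_of_isAtom a ha ⟨fun y z ↦ ?_⟩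
    have hmem : ⁅(y : L), (z : L)⁆ ∈ a ⊓ c :=
      ⟨lie_mem_right K L a y z z.2, h y z⟩
    rw [hac.inf_eq_bot] at hmem
    exact Subtype.ext hmem

/-- A finite-dimensional simple Lie algebra remains perfect after extension of scalars, hence has
a maximal ideal with simple quotient. -/
lemma LieAlgebra.IsSimple.exists_isCoatom_baseChange (F : Type*) {K Q : Type*} [Field K] [Field F]
    [Algebra K F] [LieRing Q] [LieAlgebra K Q] [FiniteDimensional K Q] [LieAlgebra.IsSimple K Q] :
    ∃ c : LieIdeal F (F ⊗[K] Q), IsCoatom c ∧ ∃ y z : F ⊗[K] Q, ⁅y, z⁆ ∉ c := by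
  have := IsSimple.nontrivial K Q
  have hperf : ⁅(⊤ : LieIdeal K Q), (⊤ : LieIdeal K Q)⁆ = ⊤ := by
    rcases IsSimple.eq_bot_or_eq_top (R := K) ⁅(⊤ : LieIdeal K Q), (⊤ : LieIdeal K Q)⁆ with h | h
    · exfalso
      refine IsSimple.non_abelian K (L := Q) ⟨fun x y ↦ ?_⟩
      rw [LieSubmodule.lie_eq_bot_iff] at h
      exact h x trivial y trivial
    · exact h
  have hperf' : ⁅(⊤ : LieIdeal F (F ⊗[K] Q)), (⊤ : LieIdeal F (F ⊗[K] Q))⁆ = ⊤ := by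
    have := LieSubmodule.lie_baseChange (A := F) (I := (⊤ : LieIdeal K Q)) (N := (⊤ : LieIdeal K Q))
    rw [hperf] at this
    simpa using this.symm
  have hne : (⊥ : LieIdeal F (F ⊗[K] Q)) ≠ ⊤ := bot_ne_top
  obtain ⟨c, hc, -⟩ := (IsCoatomic.eq_top_or_exists_le_coatom
    (⊥ : LieIdeal F (F ⊗[K] Q))).resolve_left hne
  refine ⟨c, hc, ?_⟩
  by_contra! h
  refine hc.1 (top_le_iff.mp ?_)
  rw [← hperf', LieSubmodule.lieIdeal_oper_eq_span, LieSubmodule.lieSpan_le]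
  rintro _ ⟨y, z, rfl⟩
  exact h y z

end SimpleQuotient

section SimpleFactor

open Module LieAlgebra
open scoped TensorProduct

/-- A simple finite-dimensional Lie algebra over an extension `F` of `K`, together with a
`K`-linear Lie homomorphism from `G` whose image is finite dimensional over `K` and spans over `F`,
and whose kernel is a maximal ideal. -/
structure LieAlgebra.SimpleFactor.{w, v₁, v₂, v₃} (F : Type v₁) (K : Type v₂) (G : Type v₃)
    [Field F] [Field K] [Algebra K F] [LieRing G] [LieAlgebra K G] where
  /-- The underlying type of the simple Lie algebra. -/
  carrier : Type w
  [lieRing : LieRing carrier]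
  [lieAlgebra : LieAlgebra F carrier]
  [module : Module K carrier]
  [isScalarTower : IsScalarTower K F carrier]
  [isSimple : LieAlgebra.IsSimple F carrier]
  [finiteDimensional : FiniteDimensional F carrier]
  /-- The structure homomorphism. -/
  map : G →ₗ[K] carrier
  map_lie : ∀ x y, map ⁅x, y⁆ = ⁅map x, map y⁆
  span_range : Submodule.span F (Set.range map) = ⊤
  finite_range : FiniteDimensional K (LinearMap.range map)
  ker_maximal : ∀ I : LieIdeal K G, LinearMap.ker map ≤ I.toSubmodule →
    I.toSubmodule ≤ LinearMap.ker map ∨ I = ⊤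

attribute [instance] SimpleFactor.lieRing SimpleFactor.lieAlgebra SimpleFactor.module
  SimpleFactor.isScalarTower SimpleFactor.isSimple SimpleFactor.finiteDimensional

universe u₁ u₂ u₃ u₄

variable {F : Type u₁} {K : Type u₂} {G : Type u₃} [Field F] [Field K] [Algebra K F]
  [LieRing G] [LieAlgebra K G]

lemma LieAlgebra.SimpleFactor.exists_of_simple {Q : Type u₄} [LieRing Q] [LieAlgebra K Q]
    [FiniteDimensional K Q] [LieAlgebra.IsSimple K Q] (π : G →ₗ⁅K⁆ Q)
    (hπ : Function.Surjective π) :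
    ∃ S : SimpleFactor.{max u₁ u₄} F K G, ∀ x, S.map x = 0 ↔ π x = 0 := by
  obtain ⟨c, hc, hnon⟩ := LieAlgebra.IsSimple.exists_isCoatom_baseChange F (K := K) (Q := Q)
  let s := (F ⊗[K] Q) ⧸ c
  have hsimple : LieAlgebra.IsSimple F s := LieIdeal.isSimple_quotient hc hnon
  let p : (F ⊗[K] Q) →ₗ[F] s := (LieSubmodule.Quotient.mk' c : (F ⊗[K] Q) →ₗ[F] s)
  have hp : Function.Surjective p := LieSubmodule.Quotient.surjective_mk' c
  have hplie (x y : F ⊗[K] Q) : p ⁅x, y⁆ = ⁅p x, p y⁆ := LieSubmodule.Quotient.mk_bracket c x y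
  let _ : Module K s := Module.compHom s (algebraMap K F)
  have hsmul (k : K) (y : s) : k • y = algebraMap K F k • y := rfl
  have : IsScalarTower K F s := IsScalarTower.of_algebraMap_smul fun _ _ ↦ rfl
  have hfin : FiniteDimensional F s := Module.Finite.of_surjective p hp
  let ψ : Q →ₗ[K] s :=
    { toFun := fun q ↦ p (1 ⊗ₜ q)
      map_add' := fun q r ↦ by rw [TensorProduct.tmul_add, map_add]
      map_smul' := fun k q ↦ by
        rw [RingHom.id_apply, hsmul, ← map_smul, TensorProduct.smul_tmul', TensorProduct.tmul_smul,
          TensorProduct.smul_tmul', smul_eq_mul, mul_one, Algebra.smul_def, mul_one] }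
  have hψ (q : Q) : ψ q = p (1 ⊗ₜ q) := rfl
  have hψlie (q r : Q) : ψ ⁅q, r⁆ = ⁅ψ q, ψ r⁆ := by
    rw [hψ, hψ, hψ, ← hplie, LieAlgebra.ExtendScalars.bracket_tmul, mul_one]
  have hψspan : Submodule.span F (Set.range ψ) = ⊤ := by
    rw [eq_top_iff]
    rintro y -
    obtain ⟨z, rfl⟩ := hp y
    induction z with
    | zero => rw [map_zero]; exact Submodule.zero_mem _
    | add a b ha hb => rw [map_add]; exact add_mem ha hb
    | tmul a q =>
      rw [← mul_one a, ← smul_eq_mul, ← TensorProduct.smul_tmul', map_smul]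
      exact Submodule.smul_mem _ _ (Submodule.subset_span ⟨q, rfl⟩)
  have := IsSimple.nontrivial F s
  let N : LieIdeal K Q :=
    { LinearMap.ker ψ with
      lie_mem := fun {x m} hm ↦ by
        change ψ ⁅x, m⁆ = 0
        rw [hψlie, show ψ m = 0 from hm, lie_zero] }
  have hN : N = ⊥ := by
    refine (IsSimple.eq_bot_or_eq_top (R := K) N).resolve_right fun h ↦ ?_
    have hzero : ψ = 0 := LinearMap.ext fun q ↦ (h ▸ LieSubmodule.mem_top q : q ∈ N)
    have : (⊤ : Submodule F s) ≤ ⊥ := by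
      rw [← hψspan, Submodule.span_le]
      rintro _ ⟨q, rfl⟩
      simp [hzero]
    exact bot_ne_top (le_bot_iff.mp this).symm
  have hψzero (q : Q) : ψ q = 0 ↔ q = 0 := by
    refine ⟨fun h ↦ ?_, fun h ↦ by rw [h, map_zero]⟩
    have : q ∈ N := h
    rwa [hN, LieSubmodule.mem_bot] at this
  have hrange : Set.range (ψ ∘ₗ (π : G →ₗ[K] Q)) = Set.range ψ := by
    rw [LinearMap.coe_comp]
    exact hπ.range_comp ψ
  refine ⟨
    { carrier := s
      map := ψ ∘ₗ (π : G →ₗ[K] Q)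
      map_lie := fun x y ↦ by simp [hψlie]
      span_range := by rw [hrange, hψspan]
      finite_range := by
        have : LinearMap.range (ψ ∘ₗ (π : G →ₗ[K] Q)) = LinearMap.range ψ :=
          SetLike.coe_injective hrange
        rw [this]
        infer_instance
      ker_maximal := fun I hI ↦ ?_ }, fun x ↦ hψzero (π x)⟩
  have hmem (x : G) (hx : π x = 0) : x ∈ I := hI ((hψzero _).mpr hx)
  let M : LieIdeal K Q :=
    { I.toSubmodule.map (π : G →ₗ[K] Q) with
      lie_mem := by
        rintro y _ ⟨m, hm, rfl⟩
        obtain ⟨x, rfl⟩ := hπ y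
        exact ⟨⁅x, m⁆, lie_mem_right K G I x m hm, π.map_lie x m⟩ }
  rcases IsSimple.eq_bot_or_eq_top (R := K) M with h | h
  · left
    intro x hx
    have : π x ∈ M := ⟨x, hx, rfl⟩
    rw [h] at this
    exact (hψzero _).mpr this
  · right
    refine eq_top_iff.mpr fun x _ ↦ ?_
    have : π x ∈ M := h ▸ LieSubmodule.mem_top (π x)
    obtain ⟨y, hy, hyx⟩ := this
    have hxy : x - y ∈ I := hmem _ (by rw [map_sub, sub_eq_zero]; exact hyx.symm)
    simpa using I.add_mem hxy hy

lemma LieAlgebra.SimpleFactor.exists_map_ne_zero {m : LieIdeal K G}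
    [FiniteDimensional K (G ⧸ m)] [LieAlgebra.IsSemisimple K (G ⧸ m)] {x : G} (hx : x ∉ m) :
    ∃ S : SimpleFactor.{max u₁ u₃} F K G, S.map x ≠ 0 := by
  have hx' : (LieSubmodule.Quotient.mk x : G ⧸ m) ≠ 0 :=
    fun h ↦ hx (LieSubmodule.Quotient.mk_eq_zero'.mp h)
  obtain ⟨c, hc, hxc, hnon⟩ := LieAlgebra.IsSemisimple.exists_isCoatom_notMem (K := K) hx'
  have := LieIdeal.isSimple_quotient hc hnon
  let p : G →ₗ[K] G ⧸ m := (LieSubmodule.Quotient.mk' m : G →ₗ[K] G ⧸ m)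
  let q : G ⧸ m →ₗ[K] (G ⧸ m) ⧸ c := (LieSubmodule.Quotient.mk' c : G ⧸ m →ₗ[K] (G ⧸ m) ⧸ c)
  have hq : Function.Surjective q := LieSubmodule.Quotient.surjective_mk' c
  have : FiniteDimensional K ((G ⧸ m) ⧸ c) := Module.Finite.of_surjective q hq
  let π : G →ₗ⁅K⁆ (G ⧸ m) ⧸ c := { q ∘ₗ p with map_lie' := rfl }
  obtain ⟨S, hS⟩ := SimpleFactor.exists_of_simple (F := F) π
    (hq.comp (LieSubmodule.Quotient.surjective_mk' m))
  exact ⟨S, fun h ↦ hxc (LieSubmodule.Quotient.mk_eq_zero'.mp ((hS x).mp h))⟩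

end SimpleFactor

section Transfer

open Module LieAlgebra

attribute [local instance] LieRing.ofAssociativeRing

lemma LinearMap.comp_prod_ad {K F G s : Type*} [CommRing K] [CommRing F] [LieRing G]
    [LieAlgebra K G] [LieRing s] [LieAlgebra F s] [Module K s] {φ : G →ₗ[K] s}
    (hφ : ∀ x y, φ ⁅x, y⁆ = ⁅φ x, φ y⁆) (l : List G) (z : G) :
    φ ((l.map (LieAlgebra.ad K G)).prod z) =
      (l.map fun y ↦ LieAlgebra.ad F s (φ y)).prod (φ z) := by
  induction l with
  | nil => rfl
  | cons a l ih => simp [hφ, ih]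

/-- A multilinear identity in adjoint operators passes to `F`-spans of homomorphic images. -/
lemma LieAlgebra.multilinear_ad_identity_of_span_eq_top {K F G s : Type*} [Field K] [Field F]
    [Algebra K F] [LieRing G] [LieAlgebra K G] [LieRing s] [LieAlgebra F s] [Module K s]
    [IsScalarTower K F s] {φ : G →ₗ[K] s} (hφ : ∀ x y, φ ⁅x, y⁆ = ⁅φ x, φ y⁆)
    (hspan : Submodule.span F (Set.range φ) = ⊤) {d : ℕ} {α : Equiv.Perm (Fin d) → K}
    (h : ∀ y : Fin d → G,
      ∑ σ, α σ • (List.ofFn fun k ↦ LieAlgebra.ad K G (y (σ k))).prod = 0)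
    (y : Fin d → s) :
    ∑ σ, algebraMap K F (α σ) • (List.ofFn fun k ↦ LieAlgebra.ad F s (y (σ k))).prod = 0 := by
  let M : MultilinearMap F (fun _ : Fin d ↦ s) (Module.End F s) :=
    ∑ σ, algebraMap K F (α σ) • MultilinearMap.domDomCongr σ
      ((MultilinearMap.mkPiAlgebraFin F d (Module.End F s)).compLinearMap
        fun _ ↦ (LieAlgebra.ad F s : s →ₗ[F] Module.End F s))
  have hM (y : Fin d → s) : M y =
      ∑ σ, algebraMap K F (α σ) • (List.ofFn fun k ↦ LieAlgebra.ad F s (y (σ k))).prod := by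
    simp [M]
  have hM0 : M = 0 := by
    refine MultilinearMap.ext_of_span_eq_top (g := fun _ ↦ φ) (fun _ ↦ hspan) fun x ↦ ?_
    rw [zero_apply, hM]
    refine LinearMap.ext_on hspan ?_
    rintro _ ⟨z, rfl⟩
    have hz := congrArg (fun T : Module.End K G ↦ φ (T z)) (h x)
    simp only [LinearMap.sum_apply, LinearMap.smul_apply, map_sum, map_smul, LinearMap.zero_apply,
      map_zero] at hz
    rw [LinearMap.sum_apply, LinearMap.zero_apply, ← hz]
    refine Finset.sum_congr rfl fun σ _ ↦ ?_
    have := LinearMap.comp_prod_ad (F := F) hφ (List.ofFn fun k ↦ x (σ k)) z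
    simp only [List.map_ofFn, Function.comp_def] at this
    rw [this, LinearMap.smul_apply, algebraMap_smul]
  rw [← hM, hM0, zero_apply]

end Transfer

section AbelianImage

open Module LieAlgebra

/-- In a weakly Noetherian Lie algebra, a subspace of a pointwise homomorphic image on which the
bracket vanishes is finite dimensional. -/
lemma WeaklyNoetherian.finiteDimensional_of_abelian {K G J : Type*} [Field K] [LieRing G]
    [LieAlgebra K G] (hG : WeaklyNoetherian K G) {s : J → Type*} [∀ j, LieRing (s j)]
    [∀ j, Module K (s j)] {Φ : G →ₗ[K] ∀ j, s j} (hΦ : ∀ x y j, Φ ⁅x, y⁆ j = ⁅Φ x j, Φ y j⁆)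
    {A : Submodule K (∀ j, s j)} (hA : A ≤ LinearMap.range Φ)
    (hab : ∀ a ∈ A, ∀ b ∈ A, ∀ j, ⁅a j, b j⁆ = 0) : FiniteDimensional K A := by
  have hlie (x y : G) (hx : Φ x ∈ A) (hy : Φ y ∈ A) : Φ ⁅x, y⁆ = 0 :=
    funext fun j ↦ by rw [hΦ, hab _ hx _ hy, Pi.zero_apply]
  let m : LieSubalgebra K G :=
    { A.comap Φ with
      lie_mem' := fun {x y} hx hy ↦ by
        change Φ ⁅x, y⁆ ∈ A
        rw [hlie x y hx hy]
        exact A.zero_mem }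
  have hm (x : m) : Φ x ∈ A := x.2
  let p : m →ₗ[K] A := LinearMap.codRestrict A (Φ ∘ₗ m.toSubmodule.subtype) hm
  have hp : Function.Surjective p := fun a ↦ by
    obtain ⟨x, hx⟩ := hA a.2
    exact ⟨⟨x, show Φ x ∈ A from hx ▸ a.2⟩, Subtype.ext hx⟩
  have hker : (LieAlgebra.derivedSeries K m 1).toSubmodule ≤ LinearMap.ker p := by
    rw [LieAlgebra.derivedSeries_def, LieAlgebra.derivedSeriesOfIdeal_succ,
      LieAlgebra.derivedSeriesOfIdeal_zero, LieSubmodule.lieIdeal_oper_eq_linear_span,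
      Submodule.span_le]
    rintro _ ⟨x, y, rfl⟩
    exact Subtype.ext (hlie _ _ (hm x) (hm y))
  have := hG m
  exact Module.Finite.of_surjective
    ((LieAlgebra.derivedSeries K m 1).toSubmodule.liftQ p hker) fun a ↦ by
      obtain ⟨x, rfl⟩ := hp a
      exact ⟨Submodule.Quotient.mk x, rfl⟩

end AbelianImage

section WeaklyNoetherian

open Module LieAlgebra

variable {F K G : Type*} [Field F] [Field K] [Algebra K F] [LieRing G] [LieAlgebra K G]

lemma LieAlgebra.SimpleFactor.map_nontrivial (S : SimpleFactor F K G) :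
    ∃ x, S.map x ≠ 0 := by
  by_contra! h
  have := IsSimple.nontrivial F S.carrier
  have htop : (⊤ : Submodule F S.carrier) ≤ ⊥ := by
    rw [← S.span_range, Submodule.span_le]
    rintro _ ⟨x, rfl⟩
    exact h x
  exact top_ne_bot (le_bot_iff.mp htop)

/-- Kernels of simple factors are incomparable unless equal. -/
lemma LieAlgebra.SimpleFactor.map_eq_zero_of_ker_le (S T : SimpleFactor F K G)
    (h : ∀ x, S.map x = 0 → T.map x = 0) (x : G) (hx : T.map x = 0) : S.map x = 0 := by
  let I : LieIdeal K G :=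
    { LinearMap.ker T.map with
      lie_mem := fun {y z} hz ↦ by
        change T.map ⁅y, z⁆ = 0
        rw [T.map_lie, show T.map z = 0 from hz, lie_zero] }
  rcases S.ker_maximal I h with hI | hI
  · exact hI hx
  · obtain ⟨y, hy⟩ := T.map_nontrivial
    exact absurd (hI ▸ LieSubmodule.mem_top y : y ∈ I) hy

variable [IsAlgClosed F] [CharZero F]

/-- In a weakly Noetherian Lie algebra, a family of simple factors of the same dimension has a
finite-dimensional image in the product. -/
lemma WeaklyNoetherian.finiteDimensional_range_pi (hG : WeaklyNoetherian K G) {J : Type*}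
    (S : J → SimpleFactor F K G) {n : ℕ} (hn : ∀ j, finrank F (S j).carrier = n) :
    FiniteDimensional K (LinearMap.range (LinearMap.pi fun j ↦ (S j).map)) := by
  have hΦ (x y : G) (j : J) : LinearMap.pi (fun j ↦ (S j).map) ⁅x, y⁆ j =
      ⁅LinearMap.pi (fun j ↦ (S j).map) x j, LinearMap.pi (fun j ↦ (S j).map) y j⁆ :=
    (S j).map_lie x y
  refine Submodule.finiteDimensional_of_abelian_finiteDimensional (F := F) ?_ hn ?_ ?_ ?_
    fun A hA hab ↦ hG.finiteDimensional_of_abelian hΦ hA hab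
  · rintro _ ⟨x, rfl⟩ _ ⟨y, rfl⟩
    exact ⟨⁅x, y⁆, funext fun j ↦ (S j).map_lie x y⟩
  · intro j
    rw [eq_top_iff, ← (S j).span_range]
    refine Submodule.span_mono ?_
    rintro _ ⟨x, rfl⟩
    exact ⟨⟨_, x, rfl⟩, rfl⟩
  · intro j
    rw [← LinearMap.range_comp, LinearMap.proj_pi]
    exact (S j).finite_range
  · rintro j k h _ ⟨x, rfl⟩ hx
    exact (S j).map_eq_zero_of_ker_le (S k) (fun y hy ↦ h _ ⟨y, rfl⟩ hy) x hx

end WeaklyNoetherian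

/-- An infinite-dimensional, residually semisimple, weakly Noetherian Lie
algebra satisfies no nonzero Lie polynomial identity. -/
theorem weaklyNoetherian_residually_semisimple_no_identity
    (K G : Type*) [Field K] [CharZero K] [LieRing G] [LieAlgebra K G]
    (hG : WeaklyNoetherian K G)
    (hinf : ¬ FiniteDimensional K G)
    (hres : ∀ x : G, x ≠ 0 → ∃ m : LieIdeal K G, x ∉ m ∧
      FiniteDimensional K (G ⧸ m) ∧ LieAlgebra.IsSemisimple K (G ⧸ m)) :
    ∀ (n : ℕ), 1 ≤ n → ∀ P : FreeLieAlgebra K (Fin n), P ≠ 0 →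
      ∃ f : FreeLieAlgebra K (Fin n) →ₗ⁅K⁆ G, f P ≠ 0 := by
  intro n _ P hP
  by_contra! hid
  obtain ⟨d, α, hα, h⟩ := FreeLieAlgebra.exists_multilinear_ad_identity hP hid
  let F := AlgebraicClosure K
  have hS (x : {x : G // x ≠ 0}) :
      ∃ S : LieAlgebra.SimpleFactor F K G, S.map (x : G) ≠ 0 := by
    obtain ⟨m, hm, _, _⟩ := hres x x.2
    exact LieAlgebra.SimpleFactor.exists_map_ne_zero hm
  choose S hS using hS
  have hdim (x) : Module.finrank F (S x).carrier < 4 ^ d + 9 ^ 4 ^ d + 1 :=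
    Nat.lt_succ_of_le <| LieAlgebra.finrank_le_of_multilinear_ad_identity
      (α := fun σ ↦ algebraMap K F (α σ)) (by simpa using hα)
      (LieAlgebra.multilinear_ad_identity_of_span_eq_top (S x).map_lie (S x).span_range h)
  let Φ (i : Fin (4 ^ d + 9 ^ 4 ^ d + 1)) :=
    LinearMap.pi fun j : {x // Module.finrank F (S x).carrier = i} ↦ (S j).map
  have hΦ (i) : FiniteDimensional K (LinearMap.range (Φ i)) :=
    hG.finiteDimensional_range_pi (fun j : {x // Module.finrank F (S x).carrier = i} ↦ S j)
      fun j ↦ j.2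
  let Ψ := LinearMap.pi fun i ↦ (Φ i).rangeRestrict
  refine hinf (Module.Finite.of_injective Ψ ((injective_iff_map_eq_zero Ψ).mpr fun x hx ↦ ?_))
  by_contra hx0
  refine hS ⟨x, hx0⟩ ?_
  have hi := congrArg Subtype.val (congrFun hx ⟨_, hdim ⟨x, hx0⟩⟩)
  exact congrFun hi ⟨⟨x, hx0⟩, rfl⟩
end

section
/- Let K be a field of characteristic zero and let G be a weakly Noetherian Lie algebra over K. Then every maximal Lie ideal m of G of codimension greater than 1 (i.e. the K-vector space G/m is not of dimension ≤ 1) is a characteristic ideal: D(m) ⊆ m for every K-linear derivation D of G. -/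
universe u v w

namespace WeaklyNoetherian

open Module TensorProduct

/-- A spanning family of vectors contains a basis. -/
theorem exists_basis_eq_apply {E V α : Type*} [Field E] [AddCommGroup V] [Module E V]
    [FiniteDimensional E V] {f : α → V} (hf : Submodule.span E (Set.range f) = ⊤) :
    ∃ (g : Fin (finrank E V) → α) (b : Basis (Fin (finrank E V)) E V), ∀ i, b i = f (g i) := by
  let b₀ := Basis.ofSpan hf.ge
  have : Fintype _ := FiniteDimensional.fintypeBasisIndex b₀
  let b := b₀.reindex (b₀.indexEquiv (finBasis E V))
  have hb : ∀ i, ∃ x, f x = b i := fun i =>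
    Basis.ofSpan_subset hf.ge ⟨_, (Basis.reindex_apply b₀ _ i).symm⟩
  choose g hg using hb
  exact ⟨g, b, fun i => (hg i).symm⟩

/-! ### Alternating maps and the trace -/

/-- Applying `T` to one argument at a time and summing multiplies a determinant by the trace
of `T`. -/
theorem sum_det_update {E V ι : Type*} [Field E] [AddCommGroup V] [Module E V] [Fintype ι]
    [DecidableEq ι] (b : Basis ι E V) (T : Module.End E V) (x : ι → V) :
    ∑ i, b.det (Function.update x i (T (x i))) = LinearMap.trace E V T * b.det x := by
  set M : Matrix ι ι E := b.toMatrix x with hM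
  set A : Matrix ι ι E := LinearMap.toMatrix b b T with hA
  have hupd : ∀ i, b.det (Function.update x i (T (x i))) = ((M.adjugate * A * M) i i) := by
    intro i
    rw [Basis.det_apply, Basis.toMatrix_update, ← hM, ← Matrix.cramer_apply,
      Matrix.cramer_eq_adjugate_mulVec, ← LinearMap.toMatrix_mulVec_repr b b T (x i), Matrix.mul_assoc]
    have hcol : (b.repr (x i) : ι → E) = fun j => M j i := by
      ext j; rw [hM, Basis.toMatrix_apply]
    rw [hcol, Matrix.mulVec_mulVec, ← Matrix.mul_assoc, Matrix.mul_apply]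
    rfl
  simp_rw [hupd]
  change Matrix.trace (M.adjugate * A * M) = _
  rw [Matrix.mul_assoc, Matrix.trace_mul_comm, Matrix.mul_assoc, Matrix.mul_adjugate,
    Matrix.mul_smul, Matrix.mul_one, Matrix.trace_smul, smul_eq_mul, Basis.det_apply,
    LinearMap.trace_eq_matrix_trace E b T, mul_comm]

/-- A vector-valued alternating map in `dim V` variables is a multiple of the determinant. -/
theorem alternatingMap_apply_eq_det_smul {E V W ι : Type*} [Field E] [AddCommGroup V] [Module E V]
    [AddCommGroup W] [Module E W] [Fintype ι] [DecidableEq ι] (b : Basis ι E V)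
    (f : V [⋀^ι]→ₗ[E] W) (x : ι → V) : f x = b.det x • f b := by
  have h : f = ((LinearMap.toSpanSingleton E W (f b)).compAlternatingMap b.det) := by
    refine Basis.ext_alternating b fun v hv => ?_
    obtain ⟨σ, rfl⟩ : ∃ σ : Equiv.Perm ι, ⇑σ = v :=
      ⟨Equiv.ofBijective v (Finite.injective_iff_bijective.mp hv), rfl⟩
    have h1 := f.map_perm b σ
    have h2 := b.det.map_perm b σ
    simp only [Function.comp_def] at h1 h2
    simp [h1, h2, b.det_self]
  conv_lhs => rw [h]
  simp

/-- If the products with the members of a spanning set have trace zero, the operator is zero. -/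
theorem eq_zero_of_trace_mul_eq_zero {E V : Type*} [Field E] [AddCommGroup V] [Module E V]
    [FiniteDimensional E V] {s : Set (Module.End E V)} (hs : Submodule.span E s = ⊤)
    (A : Module.End E V) (hA : ∀ w ∈ s, LinearMap.trace E V (A * w) = 0) : A = 0 := by
  have hall : ∀ B : Module.End E V, LinearMap.trace E V (A * B) = 0 := by
    intro B
    have : B ∈ Submodule.span E s := hs ▸ Submodule.mem_top
    induction this using Submodule.span_induction with
    | mem w hw => exact hA w hw
    | zero => simp
    | add x y _ _ hx hy => simp [mul_add, hx, hy]
    | smul c x _ hx => simp [hx]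
  ext p
  rw [LinearMap.zero_apply, ← Module.forall_dual_apply_eq_zero_iff E]
  intro l
  have := hall (l.smulRight p)
  have h2 : A * l.smulRight p = l.smulRight (A p) := by ext; simp
  rwa [h2, LinearMap.trace_smulRight] at this

section LieSubring

variable {K E G V : Type*} [Field K] [Field E] [Algebra K E] [LieRing G] [LieAlgebra K G]
  [LieRing V] [LieAlgebra E V]

/-- The scalars `c` such that `c • v` is in the image of `ψ`. -/
def lineScalars (ψ : G →ₛₗ[algebraMap K E] V) (v : V) : Submodule K E where
  carrier := {c | c • v ∈ Set.range ψ}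
  add_mem' := by
    rintro a b ⟨x, hx⟩ ⟨y, hy⟩
    exact ⟨x + y, by rw [map_add, hx, hy, add_smul]⟩
  zero_mem' := ⟨0, by simp⟩
  smul_mem' := by
    rintro k a ⟨x, hx⟩
    exact ⟨k • x, by rw [map_smulₛₗ, hx, smul_smul, Algebra.smul_def]⟩

theorem finiteDimensional_lineScalars (hG : WeaklyNoetherian K G) (ψ : G →ₛₗ[algebraMap K E] V)
    (hψ : ∀ x y, ψ ⁅x, y⁆ = ⁅ψ x, ψ y⁆) {v : V} (hv : v ≠ 0) :
    FiniteDimensional K (lineScalars ψ v) := by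
  obtain ⟨l, hl⟩ : ∃ l : Dual E V, l v = 1 := by
    by_contra! h
    refine hv ((Module.forall_dual_apply_eq_zero_iff E v).mp fun l => ?_)
    by_contra hne
    exact h ((l v)⁻¹ • l) (by simp [hne])
  have habel : ∀ x y, (∃ c : E, ψ x = c • v) → (∃ c : E, ψ y = c • v) → ψ ⁅x, y⁆ = 0 := by
    rintro x y ⟨c, hc⟩ ⟨d, hd⟩
    simp [hψ, hc, hd]
  let M : LieSubalgebra K G :=
    { carrier := {g | ∃ c : E, ψ g = c • v}
      add_mem' := by
        rintro x y ⟨c, hc⟩ ⟨d, hd⟩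
        exact ⟨c + d, by rw [map_add, hc, hd, add_smul]⟩
      zero_mem' := ⟨0, by simp⟩
      smul_mem' := by
        rintro k x ⟨c, hc⟩
        exact ⟨algebraMap K E k * c, by rw [map_smulₛₗ, hc, smul_smul]⟩
      lie_mem' := fun {x y} hx hy => ⟨0, by rw [habel x y hx hy, zero_smul]⟩ }
  let θ : M →ₗ[K] E :=
    { toFun := fun g => l (ψ g)
      map_add' := by simp
      map_smul' := by simp [Algebra.smul_def] }
  have hker : (LieAlgebra.derivedSeries K M 1).toSubmodule ≤ LinearMap.ker θ := by
    have : LieAlgebra.derivedSeries K M 1 = ⁅(⊤ : LieIdeal K M), (⊤ : LieIdeal K M)⁆ := by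
      simp
    rw [this, LieSubmodule.lieIdeal_oper_eq_linear_span, Submodule.span_le]
    rintro _ ⟨x, y, rfl⟩
    change l (ψ ⁅((x : M) : G), ((y : M) : G)⁆) = 0
    rw [habel _ _ (x : M).2 (y : M).2, map_zero]
  have hfin : FiniteDimensional K (M ⧸ (LieAlgebra.derivedSeries K M 1).toSubmodule) := hG M
  have hle : lineScalars ψ v ≤
      LinearMap.range ((LieAlgebra.derivedSeries K M 1).toSubmodule.liftQ θ hker) := by
    rw [Submodule.range_liftQ]
    rintro c ⟨x, hx⟩
    exact ⟨⟨x, c, hx⟩, by simp [θ, hx, hl]⟩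
  exact Submodule.finiteDimensional_of_le hle

/-- Multilinear maps that send tuples from the image of `ψ` into the image of `ψ`. -/
def imagePreserving (ψ : G →ₛₗ[algebraMap K E] V) (n : ℕ) :
    Set (MultilinearMap E (fun _ : Fin n => V) V) :=
  {μ | ∀ x : Fin n → G, μ (fun i => ψ (x i)) ∈ Set.range ψ}

/-- The multilinear map `(x₀, x₁, …) ↦ T ⁅x₀, ν (x₁, …)⁆`, as a bilinear function of
`T` and `ν`. -/
def lieCons (E V : Type*) [Field E] [LieRing V] [LieAlgebra E V] (n : ℕ) :
    Module.End E V →ₗ[E] MultilinearMap E (fun _ : Fin n => V) V →ₗ[E]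
      MultilinearMap E (fun _ : Fin (n + 1) => V) V :=
  LinearMap.mk₂ E
    (fun T ν => LinearMap.uncurryLeft
      { toFun := fun x => (T ∘ₗ LieAlgebra.ad E V x).compMultilinearMap ν
        map_add' := fun x y => by ext; simp
        map_smul' := fun c x => by ext; simp })
    (fun _ _ _ => by ext; simp) (fun _ _ _ => by ext; simp)
    (fun _ _ _ => by ext; simp) (fun _ _ _ => by ext; simp)

theorem lieCons_apply (n : ℕ) (T : Module.End E V) (ν : MultilinearMap E (fun _ : Fin n => V) V)
    (x : Fin (n + 1) → V) : lieCons E V n T ν x = T ⁅x 0, ν (Fin.tail x)⁆ := rfl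

/-- The monoid of operators generated by the adjoint action of the image of `ψ`. -/
def adMonoid (ψ : G →ₛₗ[algebraMap K E] V) : Submonoid (Module.End E V) :=
  Submonoid.closure (Set.range fun g => LieAlgebra.ad E V (ψ g))

theorem adMonoid_apply_mem_range {ψ : G →ₛₗ[algebraMap K E] V}
    (hψ : ∀ x y, ψ ⁅x, y⁆ = ⁅ψ x, ψ y⁆) {w : Module.End E V} (hw : w ∈ adMonoid ψ) :
    ∀ v ∈ Set.range ψ, w v ∈ Set.range ψ := by
  induction hw using Submonoid.closure_induction with
  | mem w hw =>
    obtain ⟨g, rfl⟩ := hw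
    rintro _ ⟨x, rfl⟩
    exact ⟨⁅g, x⁆, by simp [hψ]⟩
  | one => exact fun v hv => hv
  | mul a b _ _ ha hb => exact fun v hv => ha _ (hb v hv)

theorem lieCons_mem_imagePreserving {ψ : G →ₛₗ[algebraMap K E] V}
    (hψ : ∀ x y, ψ ⁅x, y⁆ = ⁅ψ x, ψ y⁆) {n : ℕ} {w : Module.End E V} (hw : w ∈ adMonoid ψ)
    {ν : MultilinearMap E (fun _ : Fin n => V) V} (hν : ν ∈ imagePreserving ψ n) :
    lieCons E V n w ν ∈ imagePreserving ψ (n + 1) := by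
  intro x
  rw [lieCons_apply]
  refine adMonoid_apply_mem_range hψ hw _ ?_
  obtain ⟨y, hy⟩ := hν (Fin.tail x)
  refine ⟨⁅x 0, y⁆, ?_⟩
  rw [hψ, hy]
  rfl

theorem eq_zero_of_forall_lie_eq_zero {ψ : G →ₛₗ[algebraMap K E] V}
    (had : Submodule.span E (adMonoid ψ : Set (Module.End E V)) = ⊤)
    (hne : ∃ a b : V, ⁅a, b⁆ ≠ 0) {v : V} (hv : ∀ x : V, ⁅v, x⁆ = 0) : v = 0 := by
  by_contra hv0
  have hscal : ∀ T : Module.End E V, ∃ c : E, T v = c • v := by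
    intro T
    have hT : T ∈ Submodule.span E (adMonoid ψ : Set (Module.End E V)) := had ▸ Submodule.mem_top
    induction hT using Submodule.span_induction with
    | mem w hw =>
      induction hw using Submonoid.closure_induction with
      | mem w hw =>
        obtain ⟨g, rfl⟩ := hw
        refine ⟨0, ?_⟩
        rw [LieAlgebra.ad_apply, ← lie_skew, hv, neg_zero, zero_smul]
      | one => exact ⟨1, by simp⟩
      | mul a b _ _ ha hb =>
        obtain ⟨c, hc⟩ := ha
        obtain ⟨d, hd⟩ := hb
        exact ⟨d * c, by rw [Module.End.mul_apply, hd, map_smul, hc, smul_smul]⟩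
    | zero => exact ⟨0, by simp⟩
    | add x y _ _ hx hy =>
      obtain ⟨c, hc⟩ := hx
      obtain ⟨d, hd⟩ := hy
      exact ⟨c + d, by rw [LinearMap.add_apply, hc, hd, add_smul]⟩
    | smul a x _ hx =>
      obtain ⟨c, hc⟩ := hx
      exact ⟨a * c, by rw [LinearMap.smul_apply, hc, smul_smul]⟩
  obtain ⟨a, b, hab⟩ := hne
  obtain ⟨l, hl⟩ : ∃ l : Dual E V, l v ≠ 0 := by
    by_contra! h
    exact hv0 ((Module.forall_dual_apply_eq_zero_iff E v).mp h)
  obtain ⟨c, hc⟩ := hscal (l.smulRight a)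
  refine hab ?_
  have : a = ((l v)⁻¹ * c) • v := by
    rw [← smul_smul, ← hc, LinearMap.smulRight_apply, smul_smul, inv_mul_cancel₀ hl, one_smul]
  rw [this, smul_lie, hv, smul_zero]

/-- The functionals `x ↦ l ⁅x, q⁆` span the dual space of a centerless Lie algebra. -/
theorem span_dual_lie_eq_top [FiniteDimensional E V]
    (hcenter : ∀ v : V, (∀ x : V, ⁅v, x⁆ = 0) → v = 0) :
    Submodule.span E {f : Dual E V | ∃ (l : Dual E V) (q : V), ∀ x, f x = l ⁅x, q⁆} = ⊤ := by
  set W := Submodule.span E {f : Dual E V | ∃ (l : Dual E V) (q : V), ∀ x, f x = l ⁅x, q⁆} with hW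
  have hbot : W.dualCoannihilator = ⊥ := by
    rw [eq_bot_iff]
    intro v hv
    rw [Submodule.mem_dualCoannihilator] at hv
    refine hcenter v fun q => (Module.forall_dual_apply_eq_zero_iff E _).mp fun l => ?_
    have hmem : -(l ∘ₗ (LieAlgebra.ad E V q)) ∈ W := by
      refine Submodule.subset_span ⟨l, q, fun x => ?_⟩
      rw [← lie_skew, map_neg]
      simp
    have := hv _ hmem
    rw [← lie_skew, map_neg]
    simpa using this
  have := Subspace.dualCoannihilator_dualAnnihilator_eq (W := W)
  rw [hbot, Submodule.dualAnnihilator_bot] at this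
  exact this.symm

/-- The multilinear map `x ↦ (∏ i, l i (x i)) • p`. -/
def prodDual {n : ℕ} (l : Fin n → Dual E V) (p : V) : MultilinearMap E (fun _ : Fin n => V) V :=
  ((MultilinearMap.mkPiAlgebra E (Fin n) E).compLinearMap l).smulRight p

theorem prodDual_apply {n : ℕ} (l : Fin n → Dual E V) (p : V) (x : Fin n → V) :
    prodDual l p x = (∏ i, l i (x i)) • p := by
  simp [prodDual]

theorem prodDual_mem_span [FiniteDimensional E V] {ψ : G →ₛₗ[algebraMap K E] V}
    (hψ : ∀ x y, ψ ⁅x, y⁆ = ⁅ψ x, ψ y⁆) (hspan : Submodule.span E (Set.range ψ) = ⊤)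
    (had : Submodule.span E (adMonoid ψ : Set (Module.End E V)) = ⊤)
    (hne : ∃ a b : V, ⁅a, b⁆ ≠ 0) :
    ∀ (n : ℕ) (l : Fin n → Dual E V) (p : V),
      prodDual l p ∈ Submodule.span E (imagePreserving ψ n) := by
  intro n
  induction n with
  | zero =>
    intro l p
    have hp : p ∈ Submodule.span E (Set.range ψ) := hspan ▸ Submodule.mem_top
    have hrw : prodDual l p = MultilinearMap.constLinearEquivOfIsEmpty E E (fun _ => V) V p := by
      ext x; simp [prodDual_apply]
    rw [hrw]
    clear hrw
    induction hp using Submodule.span_induction with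
    | mem v hv => exact Submodule.subset_span fun x => by simpa using hv
    | zero => rw [map_zero]; exact Submodule.zero_mem _
    | add x y _ _ hx hy => rw [map_add]; exact Submodule.add_mem _ hx hy
    | smul c x _ hx => rw [map_smul]; exact Submodule.smul_mem _ c hx
  | succ n ih =>
    intro l p
    have hcons : ∀ (T : Module.End E V) (ν : MultilinearMap E (fun _ : Fin n => V) V),
        ν ∈ Submodule.span E (imagePreserving ψ n) →
        lieCons E V n T ν ∈ Submodule.span E (imagePreserving ψ (n + 1)) := by
      intro T ν hν
      have hT : T ∈ Submodule.span E (adMonoid ψ : Set (Module.End E V)) :=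
        had ▸ Submodule.mem_top
      have hmem := Submodule.apply_mem_map₂ (lieCons E V n) hT hν
      rw [Submodule.map₂_span_span] at hmem
      refine Submodule.span_mono ?_ hmem
      rintro _ ⟨w, hw, μ, hμ, rfl⟩
      exact lieCons_mem_imagePreserving hψ hw hμ
    have hl : l 0 ∈ Submodule.span E
        {f : Dual E V | ∃ (l : Dual E V) (q : V), ∀ x, f x = l ⁅x, q⁆} :=
      (span_dual_lie_eq_top (E := E) (V := V) fun v hv => eq_zero_of_forall_lie_eq_zero had hne hv) ▸
        Submodule.mem_top
    suffices h : ∀ f ∈ Submodule.span E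
        {f : Dual E V | ∃ (l : Dual E V) (q : V), ∀ x, f x = l ⁅x, q⁆},
        prodDual (Fin.cons f (Fin.tail l) : Fin (n + 1) → Dual E V) p ∈
          Submodule.span E (imagePreserving ψ (n + 1)) by
      simpa [Fin.cons_self_tail] using h (l 0) hl
    intro f hf
    induction hf using Submodule.span_induction with
    | mem f hf =>
      obtain ⟨m, q, hm⟩ := hf
      have : prodDual (Fin.cons f (Fin.tail l) : Fin (n + 1) → Dual E V) p =
          lieCons E V n (m.smulRight p) (prodDual (Fin.tail l) q) := by
        ext x
        rw [lieCons_apply, prodDual_apply, prodDual_apply, Fin.prod_univ_succ]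
        simp [hm, Fin.tail, smul_smul, mul_comm]
      rw [this]
      exact hcons _ _ (ih _ _)
    | zero =>
      convert Submodule.zero_mem _
      ext x
      simp [prodDual_apply, Fin.prod_univ_succ]
    | add f g _ _ hf hg =>
      convert Submodule.add_mem _ hf hg
      ext x
      simp [prodDual_apply, Fin.prod_univ_succ, add_mul, add_smul]
    | smul c f _ hf =>
      convert Submodule.smul_mem _ c hf
      ext x
      simp [prodDual_apply, Fin.prod_univ_succ, mul_assoc, mul_smul]

theorem exists_det_smul_mem_range [FiniteDimensional E V] {ψ : G →ₛₗ[algebraMap K E] V}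
    (hψ : ∀ x y, ψ ⁅x, y⁆ = ⁅ψ x, ψ y⁆) (hspan : Submodule.span E (Set.range ψ) = ⊤)
    (had : Submodule.span E (adMonoid ψ : Set (Module.End E V)) = ⊤)
    (hne : ∃ a b : V, ⁅a, b⁆ ≠ 0) {n : ℕ} (b : Basis (Fin n) E V) :
    ∃ v : V, v ≠ 0 ∧ ∀ x : Fin n → G, b.det (fun i => ψ (x i)) • v ∈ Set.range ψ := by
  obtain ⟨μ, hμ, hμ0⟩ : ∃ μ ∈ imagePreserving ψ n, MultilinearMap.alternatization μ b ≠ 0 := by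
    by_contra! h
    obtain ⟨p, q, hpq⟩ := hne
    have hall : ∀ ν ∈ Submodule.span E (imagePreserving ψ n),
        MultilinearMap.alternatization ν b = 0 := by
      intro ν hν
      induction hν using Submodule.span_induction with
      | mem ν hν => exact h ν hν
      | zero => simp
      | add x y _ _ hx hy => simp [hx, hy]
      | smul c x _ hx =>
        rw [MultilinearMap.alternatization_apply] at hx ⊢
        have := congrArg (c • ·) hx
        simp only [smul_zero, Finset.smul_sum] at this
        rw [← this]
        refine Finset.sum_congr rfl fun σ _ => ?_
        rw [smul_comm]
        rfl
    have h0 := hall _ (prodDual_mem_span hψ hspan had ⟨p, q, hpq⟩ n b.coord p)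
    rw [MultilinearMap.alternatization_apply, Finset.sum_eq_single 1] at h0
    · simp [prodDual_apply] at h0
      exact hpq (by rw [h0, zero_lie])
    · intro σ _ hσ
      obtain ⟨i, hi⟩ : ∃ i, σ i ≠ i := by
        by_contra! hc
        exact hσ (Equiv.ext hc)
      rw [MultilinearMap.domDomCongr_apply, prodDual_apply,
        Finset.prod_eq_zero (Finset.mem_univ i), zero_smul, smul_zero]
      simp [hi]
    · simp
  refine ⟨_, hμ0, fun x => ?_⟩
  rw [← alternatingMap_apply_eq_det_smul, MultilinearMap.alternatization_apply]
  have hsub : ∀ σ : Equiv.Perm (Fin n),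
      Equiv.Perm.sign σ • (μ.domDomCongr σ) (fun i => ψ (x i)) ∈ ψ.toAddMonoidHom.range := by
    intro σ
    obtain ⟨y, hy⟩ := hμ (fun i => x (σ i))
    rcases Int.units_eq_one_or (Equiv.Perm.sign σ) with h | h
    · exact ⟨y, by rw [h, one_smul]; exact hy⟩
    · exact ⟨-y, by rw [h, Units.neg_smul, one_smul, map_neg]; exact congrArg Neg.neg hy⟩
  exact (AddSubgroup.sum_mem ψ.toAddMonoidHom.range fun σ _ => hsub σ)

/-- A weakly Noetherian Lie algebra acting through an absolutely irreducible finite-dimensional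
adjoint representation has finite-dimensional image. -/
theorem finiteDimensional_quotient_ker [FiniteDimensional E V] (hG : WeaklyNoetherian K G)
    {ψ : G →ₛₗ[algebraMap K E] V}
    (hψ : ∀ x y, ψ ⁅x, y⁆ = ⁅ψ x, ψ y⁆) (hspan : Submodule.span E (Set.range ψ) = ⊤)
    (had : Submodule.span E (adMonoid ψ : Set (Module.End E V)) = ⊤)
    (hne : ∃ a b : V, ⁅a, b⁆ ≠ 0) : FiniteDimensional K (G ⧸ LinearMap.ker ψ) := by
  obtain ⟨g, b, hb⟩ := exists_basis_eq_apply hspan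
  obtain ⟨v, hv, hdet⟩ := exists_det_smul_mem_range hψ hspan had hne b
  have hfin := finiteDimensional_lineScalars hG ψ hψ hv
  have htr : ∀ w ∈ adMonoid ψ, LinearMap.trace E V w ∈ lineScalars ψ v := by
    intro w hw
    have hsum := sum_det_update b w b
    rw [Basis.det_self, mul_one] at hsum
    rw [← hsum]
    refine Submodule.sum_mem _ fun i _ => ?_
    obtain ⟨y, hy⟩ := adMonoid_apply_mem_range hψ hw (b i) ⟨g i, (hb i).symm⟩
    have : Function.update (⇑b) i (w (b i)) = fun j => ψ (Function.update g i y j) := by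
      ext j
      by_cases hj : j = i
      · subst hj; simp [hy]
      · simp [hj, hb]
    rw [this]
    exact hdet _
  obtain ⟨s, hs, hsspan⟩ := (Submodule.fg_span_iff_fg_span_finset_subset
    (R := E) (adMonoid ψ : Set (Module.End E V))).mp (IsNoetherian.noetherian _)
  rw [had] at hsspan
  let θ : G →ₗ[K] (s → lineScalars ψ v) :=
    { toFun := fun x w => ⟨LinearMap.trace E V (LieAlgebra.ad E V (ψ x) * w),
        htr _ (mul_mem (Submonoid.subset_closure ⟨x, rfl⟩) (hs w.2))⟩
      map_add' := fun x y => by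
        ext w
        simp [add_mul]
      map_smul' := fun k x => by
        ext w
        change LinearMap.trace E V (LieAlgebra.ad E V (ψ (k • x)) * w) =
          k • LinearMap.trace E V (LieAlgebra.ad E V (ψ x) * w)
        rw [map_smulₛₗ, map_smul, smul_mul_assoc, map_smul, smul_eq_mul, Algebra.smul_def] }
  have hθ : LinearMap.ker θ = LinearMap.ker ψ := by
    ext x
    rw [LinearMap.mem_ker, LinearMap.mem_ker]
    constructor
    · intro hx
      have had0 : LieAlgebra.ad E V (ψ x) = 0 :=
        eq_zero_of_trace_mul_eq_zero hsspan.symm _ fun w hw =>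
          congrArg Subtype.val (congrFun hx ⟨w, hw⟩)
      refine eq_zero_of_forall_lie_eq_zero had hne fun y => ?_
      simpa using LinearMap.congr_fun had0 y
    · intro hx
      ext w
      simp [θ, hx]
  rw [← hθ]
  exact Module.Finite.equiv θ.quotKerEquivRange.symm

end LieSubring

section MaximalIdeal

variable {K G : Type*} [Field K] [LieRing G] [LieAlgebra K G] {m : LieIdeal K G}

/-- A maximal Lie ideal of codimension greater than one does not contain all brackets. -/
theorem exists_lie_notMem (hmax : IsCoatom m) (hcodim : ¬ Module.rank K (G ⧸ m) ≤ 1) :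
    ∃ a b : G, ⁅a, b⁆ ∉ m := by
  by_contra! h
  refine hcodim ?_
  obtain ⟨x, hx⟩ : ∃ x, x ∉ m := by
    by_contra! hall
    exact hmax.1 (eq_top_iff.mpr fun x _ => hall x)
  let N : LieIdeal K G :=
    { m.toSubmodule ⊔ Submodule.span K {x} with
      lie_mem := fun {a b} _ => Submodule.mem_sup_left (h a b) }
  have hN : N = ⊤ := by
    refine hmax.2 N (lt_of_le_of_ne (fun y hy => Submodule.mem_sup_left hy) ?_)
    intro heq
    exact hx (heq ▸ Submodule.mem_sup_right (Submodule.mem_span_singleton_self x))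
  refine rank_le_one_iff.mpr ⟨LieSubmodule.Quotient.mk x, fun v => ?_⟩
  obtain ⟨y, rfl⟩ := LieSubmodule.Quotient.surjective_mk' m v
  have hy : y ∈ N := hN ▸ LieSubmodule.mem_top y
  obtain ⟨a, ha, b, hb, rfl⟩ := Submodule.mem_sup.mp hy
  obtain ⟨r, rfl⟩ := Submodule.mem_span_singleton.mp hb
  refine ⟨r, ?_⟩
  rw [map_add, map_smul, (LieSubmodule.Quotient.mk_eq_zero (N := m)).mpr ha, zero_add]
  rfl

/-- If a derivation does not preserve a maximal Lie ideal, it maps it onto the quotient. -/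
theorem exists_mem_derivation_sub_mem (hmax : IsCoatom m) {D : LieDerivation K G G}
    (hD : ∃ x ∈ m, D x ∉ m) (y : G) : ∃ x ∈ m, D x - y ∈ m := by
  let N : LieIdeal K G :=
    { m.toSubmodule.map D.toLinearMap ⊔ m.toSubmodule with
      lie_mem := fun {a b} hb => by
        obtain ⟨_, ⟨x, hx, rfl⟩, z, hz, rfl⟩ := Submodule.mem_sup.mp hb
        have heq : ⁅a, D x + z⁆ = D ⁅a, x⁆ + (⁅a, z⁆ - ⁅D a, x⁆) := by
          rw [D.apply_lie_eq_add, lie_add]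
          abel
        change ⁅a, D x + z⁆ ∈ m.toSubmodule.map D.toLinearMap ⊔ m.toSubmodule
        rw [heq]
        exact Submodule.add_mem_sup ⟨_, m.lie_mem hx, rfl⟩
          (sub_mem (m.lie_mem hz) (m.lie_mem hx)) }
  have hN : N = ⊤ := by
    refine hmax.2 N (lt_of_le_of_ne (fun y hy => Submodule.mem_sup_right hy) ?_)
    intro heq
    obtain ⟨x, hx, hDx⟩ := hD
    exact hDx (heq ▸ Submodule.mem_sup_left ⟨x, hx, rfl⟩)
  have hy : y ∈ N := hN ▸ LieSubmodule.mem_top y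
  obtain ⟨_, ⟨x, hx, rfl⟩, z, hz, rfl⟩ := Submodule.mem_sup.mp hy
  refine ⟨x, hx, ?_⟩
  have : D x - (D.toLinearMap x + z) = -z := by
    change D x - (D x + z) = -z
    abel
  rw [this]
  exact neg_mem hz

theorem finiteDimensional_quotient_of_derivation (hG : WeaklyNoetherian K G) (hmax : IsCoatom m)
    {D : LieDerivation K G G} (hD : ∃ x ∈ m, D x ∉ m) : FiniteDimensional K (G ⧸ m) := by
  let M : LieSubalgebra K G := LieIdeal.toLieSubalgebra K G m
  let θ : M →ₗ[K] G ⧸ m :=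
    (LieSubmodule.Quotient.mk' m).toLinearMap ∘ₗ D.toLinearMap ∘ₗ M.toSubmodule.subtype
  have hker : (LieAlgebra.derivedSeries K M 1).toSubmodule ≤ LinearMap.ker θ := by
    have : LieAlgebra.derivedSeries K M 1 = ⁅(⊤ : LieIdeal K M), (⊤ : LieIdeal K M)⁆ := by
      simp
    rw [this, LieSubmodule.lieIdeal_oper_eq_linear_span, Submodule.span_le]
    rintro _ ⟨x, y, rfl⟩
    change LieSubmodule.Quotient.mk' m (D ⁅((x : M) : G), ((y : M) : G)⁆) = 0
    rw [LieSubmodule.Quotient.mk_eq_zero, D.apply_lie_eq_add]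
    refine add_mem (lie_mem_left K G m _ _ (x : M).2) (m.lie_mem (y : M).2)
  have hfin : FiniteDimensional K (M ⧸ (LieAlgebra.derivedSeries K M 1).toSubmodule) := hG M
  refine Module.Finite.of_surjective
    ((LieAlgebra.derivedSeries K M 1).toSubmodule.liftQ θ hker) ?_
  rw [← LinearMap.range_eq_top, Submodule.range_liftQ, LinearMap.range_eq_top]
  intro v
  obtain ⟨y, rfl⟩ := LieSubmodule.Quotient.surjective_mk' m v
  obtain ⟨x, hx, hxy⟩ := exists_mem_derivation_sub_mem hmax hD y
  refine ⟨⟨x, hx⟩, ?_⟩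
  rw [← sub_eq_zero]
  change LieSubmodule.Quotient.mk' m (D x - y) = 0
  rwa [LieSubmodule.Quotient.mk_eq_zero]

/-- If brackets with `y` are in the maximal ideal, then so is `y`. -/
theorem mem_of_forall_lie_mem (hmax : IsCoatom m) (hne : ∃ a b : G, ⁅a, b⁆ ∉ m) {y : G}
    (hy : ∀ x, ⁅y, x⁆ ∈ m) : y ∈ m := by
  by_contra hym
  let N : LieIdeal K G :=
    { m.toSubmodule ⊔ Submodule.span K {y} with
      lie_mem := fun {a b} hb => by
        obtain ⟨u, hu, v, hv, rfl⟩ := Submodule.mem_sup.mp hb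
        obtain ⟨r, rfl⟩ := Submodule.mem_span_singleton.mp hv
        refine Submodule.mem_sup_left ?_
        rw [lie_add, lie_smul, ← lie_skew a y]
        exact add_mem (m.lie_mem hu) (m.smul_mem _ (neg_mem (hy a))) }
  have hN : N = ⊤ := by
    refine hmax.2 N (lt_of_le_of_ne (fun y hy => Submodule.mem_sup_left hy) ?_)
    intro heq
    exact hym (heq ▸ Submodule.mem_sup_right (Submodule.mem_span_singleton_self y))
  obtain ⟨a, b, hab⟩ := hne
  have ha : a ∈ N := hN ▸ LieSubmodule.mem_top a
  obtain ⟨u, hu, v, hv, rfl⟩ := Submodule.mem_sup.mp ha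
  obtain ⟨r, rfl⟩ := Submodule.mem_span_singleton.mp hv
  refine hab ?_
  rw [add_lie, smul_lie]
  exact add_mem (lie_mem_left K G m _ _ hu) (m.smul_mem _ (hy b))

/-- The elements all of whose iterated derivatives of order less than `k` are in `m`. -/
def iterateMem (m : LieIdeal K G) (D : LieDerivation K G G) (k : ℕ) : Submodule K G where
  carrier := {x | ∀ j < k, D^[j] x ∈ m}
  add_mem' hx hy j hj := by
    rw [iterate_map_add]
    exact add_mem (hx j hj) (hy j hj)
  zero_mem' j _ := by
    rw [iterate_map_zero]
    exact zero_mem m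
  smul_mem' c x hx j hj := by
    have hj := m.smul_mem c (hx j hj)
    rw [← LieDerivation.coeFn_coe, ← Module.End.coe_pow] at hj ⊢
    rwa [map_smul]

theorem exists_iterate_notMem [CharZero K] (hmax : IsCoatom m) (hne : ∃ a b : G, ⁅a, b⁆ ∉ m)
    {D : LieDerivation K G G} (hD : ∃ x ∈ m, D x ∉ m) (k : ℕ) :
    ∃ g ∈ iterateMem m D k, D^[k] g ∉ m := by
  induction k with
  | zero =>
    obtain ⟨a, b, hab⟩ := hne
    exact ⟨_, fun j hj => absurd hj (Nat.not_lt_zero j), hab⟩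
  | succ k ih =>
    obtain ⟨g, hg, hgk⟩ := ih
    obtain ⟨x, hx, hDx⟩ : ∃ x ∈ m, ⁅D^[k] g, D x⁆ ∉ m := by
      by_contra! h
      refine hgk (mem_of_forall_lie_mem hmax hne fun y => ?_)
      obtain ⟨x, hx, hxy⟩ := exists_mem_derivation_sub_mem hmax hD y
      have : ⁅D^[k] g, y⁆ = ⁅D^[k] g, D x⁆ - ⁅D^[k] g, D x - y⁆ := by rw [lie_sub]; abel
      rw [this]
      exact sub_mem (h x hx) (m.lie_mem hxy)
    refine ⟨⁅g, x⁆, fun j hj => ?_, fun hmem => hDx ?_⟩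
    · rw [D.iterate_apply_lie]
      refine sum_mem fun p hp => nsmul_mem ?_ _
      rw [Finset.HasAntidiagonal.mem_antidiagonal] at hp
      by_cases hpk : p.1 < k
      · exact lie_mem_left K G m _ _ (hg _ hpk)
      · have : p.2 = 0 := by omega
        rw [this]
        exact m.lie_mem hx
    · rw [D.iterate_apply_lie, ← Finset.add_sum_erase _ _
        (show (k, 1) ∈ Finset.HasAntidiagonal.antidiagonal (k + 1) by simp)] at hmem
      have hrest : ∑ p ∈ (Finset.HasAntidiagonal.antidiagonal (k + 1)).erase (k, 1),
          (k + 1).choose p.1 • ⁅D^[p.1] g, D^[p.2] x⁆ ∈ m := by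
        refine sum_mem fun p hp => nsmul_mem ?_ _
        rw [Finset.mem_erase, Finset.HasAntidiagonal.mem_antidiagonal] at hp
        by_cases hpk : p.1 < k
        · exact lie_mem_left K G m _ _ (hg _ hpk)
        · have : p.2 = 0 := by
            by_contra h0
            exact hp.1 (Prod.ext (by simp; omega) (by simp; omega))
          rw [this]
          exact m.lie_mem hx
      have h1 := (add_mem_cancel_right hrest).mp hmem
      simp only [Nat.choose_succ_self_right, Function.iterate_one] at h1
      rw [← Nat.cast_smul_eq_nsmul K] at h1
      exact (m.toSubmodule.smul_mem_iff (Nat.cast_ne_zero.mpr k.succ_ne_zero)).mp h1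

end MaximalIdeal

/-! ### Burnside's theorem for the adjoint representation -/

theorem adjoin_ad_eq_top {F Q : Type*} [Field F] [IsAlgClosed F] [LieRing Q] [LieAlgebra F Q]
    [FiniteDimensional F Q] [Nontrivial Q] (hQ : ∀ I : LieIdeal F Q, I = ⊥ ∨ I = ⊤) :
    Algebra.adjoin F (Set.range (LieAlgebra.ad F Q)) = ⊤ := by
  set A := Algebra.adjoin F (Set.range (LieAlgebra.ad F Q)) with hA
  have hsimple : IsSimpleModule A Q := by
    refine (isSimpleModule_iff _ _).mpr { eq_bot_or_eq_top := fun U => ?_ }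
    let I : LieIdeal F Q :=
      { U.restrictScalars F with
        lie_mem := fun {a b} hb =>
          U.smul_mem (⟨LieAlgebra.ad F Q a, Algebra.subset_adjoin ⟨a, rfl⟩⟩ : A) hb }
    refine (hQ I).imp (fun h => ?_) fun h => ?_
    · refine (Submodule.eq_bot_iff U).mpr fun x hx => ?_
      have : x ∈ I := hx
      rwa [h, LieSubmodule.mem_bot] at this
    · refine eq_top_iff.mpr fun x _ => ?_
      have : x ∈ I := h ▸ LieSubmodule.mem_top x
      exact this
  rw [eq_top_iff]
  intro T _
  classical
  let T' : Module.End (Module.End A Q) Q :=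
    { toFun := T
      map_add' := map_add T
      map_smul' := fun e x => by
        obtain ⟨c, rfl⟩ := (IsSimpleModule.algebraMap_end_bijective_of_isAlgClosed F
          (A := A) (V := Q)).2 e
        simp }
  obtain ⟨r, hr⟩ := jacobson_density T' (Finset.univ.image (finBasis F Q))
  have : T = r := by
    refine (finBasis F Q).ext fun i => ?_
    exact hr _ (Finset.mem_image_of_mem _ (Finset.mem_univ i))
  rw [this]
  exact r.2

/-- The quotient by a maximal ideal maps, with dense image, to a simple Lie algebra over an
algebraically closed field whose adjoint representation is absolutely irreducible. -/
theorem exists_simple_extension {K : Type u} {G : Type v} (F : Type w) [Field K] [Field F]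
    [Algebra K F] [IsAlgClosed F] [LieRing G] [LieAlgebra K G] {m : LieIdeal K G} (hmax : IsCoatom m)
    [FiniteDimensional K (G ⧸ m)] :
    ∃ (P : Type (max w v)) (_ : LieRing P) (_ : LieAlgebra F P) (I : LieIdeal F P)
      (φ : G →ₛₗ[algebraMap K F] P ⧸ I),
      FiniteDimensional F (P ⧸ I) ∧ (∀ x y, φ ⁅x, y⁆ = ⁅φ x, φ y⁆) ∧
      Submodule.span F (Set.range φ) = ⊤ ∧ (∀ x, φ x = 0 ↔ x ∈ m) ∧
      Algebra.adjoin F (Set.range (LieAlgebra.ad F (P ⧸ I))) = ⊤ := by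
  let P := F ⊗[K] (G ⧸ m)
  have hne : ∃ x, x ∉ m := by
    by_contra! hall
    exact hmax.1 (eq_top_iff.mpr fun x _ => hall x)
  have : Nontrivial (G ⧸ m) := by
    obtain ⟨x, hx⟩ := hne
    exact ⟨⟨LieSubmodule.Quotient.mk' m x, 0,
      fun h => hx ((LieSubmodule.Quotient.mk_eq_zero (N := m)).mp h)⟩⟩
  have hP : Nontrivial P := inferInstance
  have hbt : (⊥ : LieIdeal F P) ≠ ⊤ := by
    obtain ⟨p, hp⟩ := exists_ne (0 : P)
    intro h
    exact hp ((LieSubmodule.mem_bot (R := F) (L := P) p).mp (h ▸ LieSubmodule.mem_top p))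
  obtain ⟨I, hI, -⟩ := (eq_top_or_exists_le_coatom (⊥ : LieIdeal F P)).resolve_left hbt
  let φ : G →ₛₗ[algebraMap K F] P ⧸ I :=
    { toFun := fun x => LieSubmodule.Quotient.mk' I (1 ⊗ₜ[K] LieSubmodule.Quotient.mk' m x : P)
      map_add' := fun x y => by rw [map_add, TensorProduct.tmul_add, map_add]
      map_smul' := fun k x => by
        rw [map_smul, ← TensorProduct.smul_tmul, ← map_smul, TensorProduct.smul_tmul',
          Algebra.smul_def, smul_eq_mul] }
  have hφ : ∀ x y, φ ⁅x, y⁆ = ⁅φ x, φ y⁆ := by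
    intro x y
    have : (1 ⊗ₜ[K] LieSubmodule.Quotient.mk' m ⁅x, y⁆ : P) =
        ⁅(1 ⊗ₜ[K] LieSubmodule.Quotient.mk' m x : P),
          (1 ⊗ₜ[K] LieSubmodule.Quotient.mk' m y : P)⁆ := by
      rw [LieAlgebra.ExtendScalars.bracket_tmul, one_mul]
      rfl
    change LieSubmodule.Quotient.mk' I _ = _
    rw [this]
    rfl
  have hspan : Submodule.span F (Set.range φ) = ⊤ := by
    rw [eq_top_iff]
    rintro q -
    obtain ⟨p, rfl⟩ := LieSubmodule.Quotient.surjective_mk' I q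
    induction p using TensorProduct.induction_on with
    | zero => rw [map_zero]; exact Submodule.zero_mem _
    | tmul a s =>
      obtain ⟨x, rfl⟩ := LieSubmodule.Quotient.surjective_mk' m s
      have : (a ⊗ₜ[K] LieSubmodule.Quotient.mk' m x : P) =
          a • (1 ⊗ₜ[K] LieSubmodule.Quotient.mk' m x : P) := by
        rw [TensorProduct.smul_tmul', smul_eq_mul, mul_one]
      rw [this, map_smul]
      exact Submodule.smul_mem _ _ (Submodule.subset_span ⟨x, rfl⟩)
    | add x y hx hy => rw [map_add]; exact Submodule.add_mem _ hx hy
  have hQ : Nontrivial (P ⧸ I) := by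
    obtain ⟨p, hp⟩ : ∃ p, p ∉ I := by
      by_contra! hall
      exact hI.1 (eq_top_iff.mpr fun x _ => hall x)
    exact ⟨⟨LieSubmodule.Quotient.mk' I p, 0,
      fun h => hp ((LieSubmodule.Quotient.mk_eq_zero (N := I)).mp h)⟩⟩
  have hfin : FiniteDimensional F (P ⧸ I) :=
    Module.Finite.of_surjective (LieSubmodule.Quotient.mk' I).toLinearMap
      (LieSubmodule.Quotient.surjective_mk' I)
  refine ⟨P, inferInstance, inferInstance, I, φ, hfin, hφ, hspan, ?_, ?_⟩
  · let N : LieIdeal K G :=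
      { LinearMap.ker φ with
        lie_mem := fun {a b} hb => by
          change φ ⁅a, b⁆ = 0
          rw [hφ, show φ b = 0 from hb, lie_zero] }
    have hN : N ≠ ⊤ := by
      intro h
      have hz : ∀ x, φ x = 0 := fun x => (h ▸ LieSubmodule.mem_top x : x ∈ N)
      have : Set.range φ = {0} := by
        ext q
        simp [hz, eq_comm]
      rw [this, Submodule.span_zero_singleton] at hspan
      exact bot_ne_top hspan
    have hle : m ≤ N := fun x hx => by
      change LieSubmodule.Quotient.mk' I (1 ⊗ₜ[K] LieSubmodule.Quotient.mk' m x : P) = 0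
      rw [(LieSubmodule.Quotient.mk_eq_zero (N := m)).mpr hx, TensorProduct.tmul_zero, map_zero]
    have heq : N = m := (hmax.le_iff.mp hle).resolve_left hN
    exact fun x => SetLike.ext_iff.mp heq x
  · refine adjoin_ad_eq_top fun J => ?_
    let J' : LieIdeal F P :=
      { J.toSubmodule.comap (LieSubmodule.Quotient.mk' I).toLinearMap with
        lie_mem := fun {a b} hb =>
          (J.lie_mem hb : ⁅LieSubmodule.Quotient.mk' I a, LieSubmodule.Quotient.mk' I b⁆ ∈ J) }
    have hle : I ≤ J' := fun p hp => by
      change LieSubmodule.Quotient.mk' I p ∈ J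
      rw [(LieSubmodule.Quotient.mk_eq_zero (N := I)).mpr hp]
      exact zero_mem J
    rcases hI.le_iff.mp hle with h | h
    · right
      refine eq_top_iff.mpr fun q _ => ?_
      obtain ⟨p, rfl⟩ := LieSubmodule.Quotient.surjective_mk' I q
      exact (h ▸ LieSubmodule.mem_top p : p ∈ J')
    · left
      refine (LieSubmodule.eq_bot_iff J).mpr fun q hq => ?_
      obtain ⟨p, rfl⟩ := LieSubmodule.Quotient.surjective_mk' I q
      have hp : p ∈ J' := hq
      rw [h] at hp
      exact (LieSubmodule.Quotient.mk_eq_zero (N := I)).mpr hp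

section BaseChange

variable {F E Q ι : Type*} [Field F] [Field E] [Algebra F E] [LieRing Q] [LieAlgebra F Q]

/-- Absolute irreducibility of the adjoint representation passes to extensions of scalars, where it
suffices to consider a spanning set. -/
theorem adjoin_ad_baseChange_eq_top [FiniteDimensional F Q]
    (hQ : Algebra.adjoin F (Set.range (LieAlgebra.ad F Q)) = ⊤) {s : Set (E ⊗[F] Q)}
    (hs : Submodule.span E s = ⊤) :
    Algebra.adjoin E (LieAlgebra.ad E (E ⊗[F] Q) '' s) = ⊤ := by
  set A := Algebra.adjoin E (LieAlgebra.ad E (E ⊗[F] Q) '' s) with hA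
  have had : ∀ v, LieAlgebra.ad E (E ⊗[F] Q) v ∈ A := by
    intro v
    have hv : v ∈ Submodule.span E s := hs ▸ Submodule.mem_top
    induction hv using Submodule.span_induction with
    | mem v hv => exact Algebra.subset_adjoin ⟨v, hv, rfl⟩
    | zero => rw [map_zero]; exact A.zero_mem
    | add x y _ _ hx hy => rw [map_add]; exact A.add_mem hx hy
    | smul c x _ hx => rw [map_smul]; exact A.smul_mem hx c
  have hbase : ∀ T : Module.End F Q, T.baseChange E ∈ A := by
    intro T
    have hT : T ∈ Algebra.adjoin F (Set.range (LieAlgebra.ad F Q)) := hQ ▸ Algebra.mem_top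
    induction hT using Algebra.adjoin_induction with
    | mem T hT =>
      obtain ⟨q, rfl⟩ := hT
      have : (LieAlgebra.ad F Q q).baseChange E = LieAlgebra.ad E (E ⊗[F] Q) (1 ⊗ₜ q) := by
        ext x
        simp
      rw [this]
      exact had _
    | algebraMap r =>
      have : (algebraMap F (Module.End F Q) r).baseChange E =
          algebraMap E (Module.End E (E ⊗[F] Q)) (algebraMap F E r) := by
        ext x
        simp [Algebra.algebraMap_eq_smul_one, TensorProduct.smul_tmul']
      rw [this]
      exact A.algebraMap_mem _
    | add x y _ _ hx hy => rw [LinearMap.baseChange_add]; exact A.add_mem hx hy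
    | mul x y _ _ hx hy =>
      have : (x * y).baseChange E = x.baseChange E * y.baseChange E := by
        ext; simp
      rw [this]
      exact A.mul_mem hx hy
  rw [eq_top_iff]
  intro T _
  let b := Module.finBasis F Q
  let B := Algebra.TensorProduct.basis E b
  have : T = ∑ i, ∑ j, B.repr (T (B j)) i • ((b.coord j).smulRight (b i)).baseChange E := by
    refine B.ext fun k => ?_
    simp only [LinearMap.sum_apply, LinearMap.smul_apply]
    conv_lhs => rw [← B.sum_repr (T (B k))]
    refine Finset.sum_congr rfl fun i _ => ?_
    rw [Finset.sum_eq_single k]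
    · simp [B]
    · intro j _ hj
      simp [B, hj.symm]
    · simp
  rw [this]
  exact A.sum_mem fun i _ => A.sum_mem fun j _ => A.smul_mem (hbase _) _

/-- The element of `E ⊗ Q` determined by a formal power series with coefficients in `Q`. -/
noncomputable def seriesTensor [Fintype ι] (b : Basis ι F Q) (e : PowerSeries F →ₐ[F] E)
    (s : ℕ → Q) : E ⊗[F] Q :=
  ∑ i, e (PowerSeries.mk fun n => b.coord i (s n)) • (1 ⊗ₜ[F] b i)

variable [Fintype ι] (b : Basis ι F Q) (e : PowerSeries F →ₐ[F] E)

theorem repr_seriesTensor (s : ℕ → Q) (i : ι) :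
    (Algebra.TensorProduct.basis E b).repr (seriesTensor b e s) i =
      e (PowerSeries.mk fun n => b.coord i (s n)) := by
  classical
  simp only [seriesTensor, ← Algebra.TensorProduct.basis_apply]
  rw [Basis.repr_sum_self]

theorem seriesTensor_add (s t : ℕ → Q) :
    seriesTensor b e (s + t) = seriesTensor b e s + seriesTensor b e t := by
  rw [seriesTensor, seriesTensor, seriesTensor, ← Finset.sum_add_distrib]
  refine Finset.sum_congr rfl fun i _ => ?_
  rw [← add_smul, ← map_add]
  congr 2
  ext n
  simp

theorem seriesTensor_smul (c : F) (s : ℕ → Q) :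
    seriesTensor b e (c • s) = algebraMap F E c • seriesTensor b e s := by
  rw [seriesTensor, seriesTensor, Finset.smul_sum]
  refine Finset.sum_congr rfl fun i _ => ?_
  rw [smul_smul, ← Algebra.smul_def, ← map_smul]
  congr 2
  ext n
  simp

theorem seriesTensor_lie (s t : ℕ → Q) :
    ⁅seriesTensor b e s, seriesTensor b e t⁆ = seriesTensor b e
      (fun n => ∑ p ∈ Finset.HasAntidiagonal.antidiagonal n, ⁅s p.1, t p.2⁆) := by
  set S : ι → PowerSeries F := fun i => PowerSeries.mk fun n => b.coord i (s n) with hS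
  set T : ι → PowerSeries F := fun i => PowerSeries.mk fun n => b.coord i (t n) with hT
  have hcoeff : ∀ k, (PowerSeries.mk fun n => b.coord k
      (∑ p ∈ Finset.HasAntidiagonal.antidiagonal n, ⁅s p.1, t p.2⁆)) =
      ∑ i, ∑ j, b.coord k ⁅b i, b j⁆ • (S i * T j) := by
    intro k
    ext n
    have hexp : ∀ x y : Q, b.coord k ⁅x, y⁆ =
        ∑ i, ∑ j, b.coord k ⁅b i, b j⁆ * (b.coord i x * b.coord j y) := by
      intro x y
      conv_lhs => rw [← b.sum_repr x, ← b.sum_repr y]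
      rw [sum_lie, map_sum]
      refine Finset.sum_congr rfl fun i _ => ?_
      rw [lie_sum, map_sum]
      refine Finset.sum_congr rfl fun j _ => ?_
      rw [smul_lie, lie_smul, map_smul, map_smul, smul_eq_mul, smul_eq_mul, Basis.coord_apply,
        Basis.coord_apply, Basis.coord_apply]
      ring
    rw [PowerSeries.coeff_mk, map_sum, Finset.sum_congr rfl fun p _ => hexp (s p.1) (t p.2),
      Finset.sum_comm, map_sum]
    refine Finset.sum_congr rfl fun i _ => ?_
    rw [Finset.sum_comm, map_sum]
    refine Finset.sum_congr rfl fun j _ => ?_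
    rw [map_smul, PowerSeries.coeff_mul, smul_eq_mul, Finset.mul_sum]
    simp only [hS, hT, PowerSeries.coeff_mk]
  have hlie : ∀ i j, (1 ⊗ₜ[F] ⁅b i, b j⁆ : E ⊗[F] Q) =
      ∑ k, algebraMap F E (b.coord k ⁅b i, b j⁆) • (1 ⊗ₜ[F] b k) := by
    intro i j
    conv_lhs => rw [← b.sum_repr ⁅b i, b j⁆, TensorProduct.tmul_sum]
    refine Finset.sum_congr rfl fun k _ => ?_
    rw [algebraMap_smul, TensorProduct.tmul_smul]
    rfl
  simp only [seriesTensor]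
  simp only [hcoeff]
  simp only [map_sum, map_smul, Finset.sum_smul]
  rw [sum_lie, Finset.sum_comm]
  refine Finset.sum_congr rfl fun i _ => ?_
  rw [lie_sum, Finset.sum_comm]
  refine Finset.sum_congr rfl fun j _ => ?_
  rw [smul_lie, lie_smul, LieAlgebra.ExtendScalars.bracket_tmul, one_mul, hlie, smul_smul,
    Finset.smul_sum]
  refine Finset.sum_congr rfl fun k _ => ?_
  rw [smul_smul, map_mul, Algebra.smul_def, mul_comm]

end BaseChange

section Taylor

variable {K G F E Q ι : Type*} [Field K] [LieRing G] [LieAlgebra K G] [Field F] [Algebra K F]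
  [Field E] [Algebra K E] [Algebra F E] [IsScalarTower K F E] [LieRing Q] [LieAlgebra F Q]
  [Fintype ι]

/-- The formal Taylor expansion `x ↦ ∑ φ (Dⁿ x) tⁿ / n!` of `φ` along the derivation `D`. -/
noncomputable def taylor (b : Basis ι F Q) (e : PowerSeries F →ₐ[F] E)
    (φ : G →ₛₗ[algebraMap K F] Q) (D : LieDerivation K G G) :
    G →ₛₗ[algebraMap K E] E ⊗[F] Q where
  toFun x := seriesTensor b e fun n => (n.factorial : F)⁻¹ • φ (D^[n] x)
  map_add' x y := by
    rw [← seriesTensor_add]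
    congr 1
    ext n
    rw [iterate_map_add, map_add, smul_add]
    rfl
  map_smul' k x := by
    rw [IsScalarTower.algebraMap_apply K F E, ← seriesTensor_smul]
    congr 1
    ext n
    have hsmul : D^[n] (k • x) = k • D^[n] x :=
      (Function.Commute.iterate_left (g := (k • · : G → G)) (fun y => map_smul D k y) n).eq x
    rw [hsmul, LinearMap.map_smulₛₗ, smul_comm]
    rfl

variable (b : Basis ι F Q) (e : PowerSeries F →ₐ[F] E)
  {φ : G →ₛₗ[algebraMap K F] Q} (D : LieDerivation K G G)

theorem taylor_lie [CharZero F] (hφ : ∀ x y, φ ⁅x, y⁆ = ⁅φ x, φ y⁆) (x y : G) :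
    taylor b e φ D ⁅x, y⁆ = ⁅taylor b e φ D x, taylor b e φ D y⁆ := by
  change seriesTensor b e _ = ⁅seriesTensor b e _, seriesTensor b e _⁆
  rw [seriesTensor_lie]
  congr 1
  ext n
  rw [D.iterate_apply_lie, map_sum, Finset.smul_sum]
  refine Finset.sum_congr rfl fun p hp => ?_
  obtain rfl := Finset.HasAntidiagonal.mem_antidiagonal.mp hp
  rw [map_nsmul, hφ, smul_lie, lie_smul, smul_smul, ← Nat.cast_smul_eq_nsmul F, smul_smul]
  congr 1
  have h1 : ((p.1 + p.2).factorial : F) ≠ 0 := Nat.cast_ne_zero.mpr (Nat.factorial_ne_zero _)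
  have h2 : (p.1.factorial : F) ≠ 0 := Nat.cast_ne_zero.mpr (Nat.factorial_ne_zero _)
  have h3 : (p.2.factorial : F) ≠ 0 := Nat.cast_ne_zero.mpr (Nat.factorial_ne_zero _)
  have h4 : ((p.1 + p.2).choose p.1 : F) * p.1.factorial * p.2.factorial =
      (p.1 + p.2).factorial := by
    rw [Nat.choose_symm_add]
    exact_mod_cast Nat.add_choose_mul_factorial_mul_factorial p.1 p.2
  field_simp
  linear_combination h4

theorem apply_iterate_eq_zero_of_taylor_eq_zero [CharZero F] (he : Function.Injective e) {x : G}
    (hx : taylor b e φ D x = 0) (n : ℕ) : φ (D^[n] x) = 0 := by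
  refine b.ext_elem fun i => ?_
  have h : e (PowerSeries.mk fun n => b.coord i ((n.factorial : F)⁻¹ • φ (D^[n] x))) = 0 := by
    rw [← repr_seriesTensor]
    change (Algebra.TensorProduct.basis E b).repr (taylor b e φ D x) i = 0
    rw [hx, map_zero, Finsupp.zero_apply]
  have h' := congrArg (PowerSeries.coeff n) ((map_eq_zero_iff e he).mp h)
  rw [PowerSeries.coeff_mk, map_zero, map_smul, smul_eq_mul, mul_eq_zero] at h'
  rw [map_zero, Finsupp.zero_apply]
  exact h'.resolve_left (inv_ne_zero (Nat.cast_ne_zero.mpr (Nat.factorial_ne_zero _)))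

theorem span_range_taylor (he : Function.Injective e) {g : ι → G} (hg : ∀ i, b i = φ (g i)) :
    Submodule.span E (Set.range (taylor b e φ D)) = ⊤ := by
  classical
  set B := Algebra.TensorProduct.basis E b with hB
  let N : Matrix ι ι (PowerSeries F) := Matrix.of fun i j =>
    PowerSeries.mk fun n => b.coord i ((n.factorial : F)⁻¹ • φ (D^[n] (g j)))
  have hN : PowerSeries.constantCoeff N.det = 1 := by
    rw [RingHom.map_det]
    have hone : PowerSeries.constantCoeff.mapMatrix N = 1 := by
      ext i j
      simp [N, ← hg, Matrix.one_apply, Finsupp.single_apply, eq_comm]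
    rw [hone, Matrix.det_one]
  have hdet : B.det (fun i => taylor b e φ D (g i)) = e N.det := by
    rw [Basis.det_apply, AlgHom.map_det]
    congr 1
    ext i j
    exact repr_seriesTensor b e _ i
  have hne : B.det (fun i => taylor b e φ D (g i)) ≠ 0 := by
    rw [hdet, Ne, map_eq_zero_iff e he]
    intro h
    rw [h, map_zero] at hN
    exact zero_ne_one hN
  rw [eq_top_iff, ← (B.is_basis_iff_det.mpr (isUnit_iff_ne_zero.mpr hne)).2]
  refine Submodule.span_mono ?_
  rintro _ ⟨i, rfl⟩
  exact ⟨g i, rfl⟩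

end Taylor

/-- If `m` is not stable under `D`, then the submodules `iterateMem m D k` strictly decrease, so no
subspace contained in all of them has finite codimension. -/
theorem not_finiteDimensional_quotient {K G : Type*} [Field K] [CharZero K] [LieRing G]
    [LieAlgebra K G] {m : LieIdeal K G} {D : LieDerivation K G G} (hmax : IsCoatom m)
    (hne : ∃ a b : G, ⁅a, b⁆ ∉ m) (hD : ∃ x ∈ m, D x ∉ m) {N : Submodule K G}
    (hN : ∀ k, N ≤ iterateMem m D k) : ¬ FiniteDimensional K (G ⧸ N) := by
  intro _
  let f : ℕ →o (Submodule K (G ⧸ N))ᵒᵈ :=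
    { toFun := fun k => OrderDual.toDual ((iterateMem m D k).map N.mkQ)
      monotone' := fun i j hij =>
        Submodule.map_mono fun x hx l hl => hx l (hl.trans_le hij) }
  obtain ⟨n, hn⟩ := IsArtinian.monotone_stabilizes f
  obtain ⟨g, hg, hg'⟩ := exists_iterate_notMem hmax hne hD n
  have heq : (iterateMem m D n).map N.mkQ = (iterateMem m D (n + 1)).map N.mkQ :=
    hn (n + 1) n.le_succ
  have hmem : N.mkQ g ∈ (iterateMem m D (n + 1)).map N.mkQ :=
    heq ▸ Submodule.mem_map_of_mem hg
  obtain ⟨y, hy, hyg⟩ := hmem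
  have hsub : y - g ∈ N := (Submodule.Quotient.eq N).mp hyg
  have : g ∈ iterateMem m D (n + 1) := by
    rw [← sub_sub_cancel y g]
    exact Submodule.sub_mem _ hy (hN _ hsub)
  exact hg' (this n n.lt_succ_self)

end WeaklyNoetherian

/-- In a weakly Noetherian Lie algebra, every maximal Lie ideal of
codimension greater than one is characteristic. -/
theorem weaklyNoetherian_maximal_ideal_characteristic
    (K G : Type*) [Field K] [CharZero K] [LieRing G] [LieAlgebra K G]
    (hG : WeaklyNoetherian K G)
    (m : LieIdeal K G) (hmax : IsCoatom m)
    (hcodim : ¬ Module.rank K (G ⧸ m) ≤ 1) :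
    ∀ D : LieDerivation K G G, ∀ x ∈ m, D x ∈ m := by
  by_contra! hcon
  obtain ⟨D, hD⟩ := hcon
  have hne := WeaklyNoetherian.exists_lie_notMem hmax hcodim
  have hfin : FiniteDimensional K (G ⧸ m) :=
    WeaklyNoetherian.finiteDimensional_quotient_of_derivation hG hmax hD
  let F := AlgebraicClosure K
  let E := FractionRing (PowerSeries F)
  have hchar : CharZero F := charZero_of_injective_algebraMap (algebraMap K F).injective
  obtain ⟨P, _, _, I, φ, _, hφ, hspan, hker, had⟩ :=
    WeaklyNoetherian.exists_simple_extension F hmax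
  let e : PowerSeries F →ₐ[F] E := IsScalarTower.toAlgHom F (PowerSeries F) E
  have he : Function.Injective e := IsFractionRing.injective (PowerSeries F) E
  obtain ⟨g, b, hg⟩ := WeaklyNoetherian.exists_basis_eq_apply hspan
  let ψ := WeaklyNoetherian.taylor b e φ D
  have hψ := WeaklyNoetherian.taylor_lie b e D hφ
  have hψspan := WeaklyNoetherian.span_range_taylor b e D he hg
  have hψker : ∀ x, ψ x = 0 → ∀ n, D^[n] x ∈ m := fun x hx n => (hker _).mp
    (WeaklyNoetherian.apply_iterate_eq_zero_of_taylor_eq_zero b e D he hx n)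
  refine WeaklyNoetherian.not_finiteDimensional_quotient hmax hne hD
    (N := LinearMap.ker ψ) (fun k x hx j _ => hψker x hx j)
    (WeaklyNoetherian.finiteDimensional_quotient_ker hG hψ hψspan ?_ ?_)
  · rw [WeaklyNoetherian.adMonoid, ← Algebra.adjoin_eq_span, Set.range_comp',
      WeaklyNoetherian.adjoin_ad_baseChange_eq_top had hψspan]
    rfl
  · obtain ⟨x, y, hxy⟩ := hne
    refine ⟨ψ x, ψ y, fun h => hxy (hψker _ ((hψ x y).trans h) 0)⟩
end
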